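/- arXiv:1106.5772 — 5 statements merged into one kernel-verified Lean document; each statement's English description precedes it below -/
import Mathlib

section
/- Let D_R ⊂ ℝ² be the closed disk of radius R > 0 centered at the origin, f a smooth real-valued function on D_R, and a, b ∈ ℝ. Then a² ∫_{D_R} |∇f(x)|² dx + b² ∫_{D_R} f(x)⁶ dx ≥ a b ∫_{D_R} (1/(2|x|) − 1/R) f(x)⁴ dx. -/
open MeasureTheory Metric

lemma polar_nonneg (K : EuclideanSpace ℝ (Fin 2) → ℝ)
    (h : ∀ w : EuclideanSpace ℝ (Fin 2), ‖w‖ = 1 →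
      0 ≤ ∫ r in Set.Ioi (0:ℝ), r * K (r • w)) : 0 ≤ ∫ x, K x := by
  have e1 : ∫ x, K x = ∫ p, K ((p.2 : ℝ) • (p.1 : EuclideanSpace ℝ (Fin 2)))
      ∂((volume : Measure (EuclideanSpace ℝ (Fin 2))).toSphere.prod (.volumeIoiPow 1)) := by
    have h1 := (volume : Measure (EuclideanSpace ℝ (Fin 2))).measurePreserving_homeomorphUnitSphereProd
    have hd : Module.finrank ℝ (EuclideanSpace ℝ (Fin 2)) - 1 = 1 := by simp
    rw [hd] at h1
    rw [← h1.integral_comp (Homeomorph.measurableEmbedding _)]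
    have h2 : ∀ x : ({0}ᶜ : Set (EuclideanSpace ℝ (Fin 2))),
        ((homeomorphUnitSphereProd _ x).2 : ℝ) •
          ((homeomorphUnitSphereProd _ x).1 : EuclideanSpace ℝ (Fin 2)) = x := by
      intro x
      have hx : ‖(x : EuclideanSpace ℝ (Fin 2))‖ ≠ 0 := norm_ne_zero_iff.2 x.2
      simp [smul_smul, hx]
    simp only [h2]
    rw [integral_subtype_comap (measurableSet_singleton _).compl K,
        restrict_compl_singleton]
  rw [e1]
  by_cases hi : Integrable (fun p : sphere (0 : EuclideanSpace ℝ (Fin 2)) 1 × Set.Ioi (0:ℝ) =>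
      K ((p.2 : ℝ) • (p.1 : EuclideanSpace ℝ (Fin 2))))
      ((volume : Measure (EuclideanSpace ℝ (Fin 2))).toSphere.prod (.volumeIoiPow 1))
  · rw [integral_prod _ hi]
    refine integral_nonneg fun w => ?_
    have hw := h w (by simp)
    simp only [Measure.volumeIoiPow, ENNReal.ofReal]
    rw [integral_withDensity_eq_integral_smul,
      integral_subtype_comap measurableSet_Ioi
        fun r : ℝ => Real.toNNReal (r ^ 1) • K (r • (w : EuclideanSpace ℝ (Fin 2)))]
    · refine hw.trans_eq (setIntegral_congr_fun measurableSet_Ioi fun r hr => ?_)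
      have hr : 0 ≤ r := le_of_lt hr
      simp [NNReal.smul_def, hr]
    · exact (measurable_subtype_coe.pow_const _).real_toNNReal
  · rw [integral_undef hi]

lemma oneD (R : ℝ) (hR : 0 < R) (a b : ℝ) (u g N : ℝ → ℝ)
    (hfc : ContinuousOn u (Set.Icc 0 R)) (hgc : ContinuousOn g (Set.Icc 0 R))
    (hNc : ContinuousOn N (Set.Icc 0 R))
    (hder : ∀ r ∈ Set.Ioo 0 R, HasDerivAt u (g r) r)
    (hgN : ∀ r ∈ Set.Ioc 0 R, g r ^ 2 ≤ N r ^ 2) :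
    0 ≤ ∫ r in Set.Ioc (0:ℝ) R, r *
      (a ^ 2 * N r ^ 2 + b ^ 2 * u r ^ 6 - a * b * ((1 / (2 * r) - 1 / R) * u r ^ 4)) := by
  -- the exact derivative
  have hF : ∫ r in (0:ℝ)..R, ((1 - 2 * r / R) * u r ^ 4 +
      (r - r ^ 2 / R) * (4 * u r ^ 3 * g r)) = 0 := by
    rw [intervalIntegral.integral_eq_sub_of_hasDerivAt_of_le hR.le
      (f := fun r => (r - r ^ 2 / R) * u r ^ 4)]
    · field_simp
      simp
    · fun_prop (disch := simp [hR.ne'])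
    · intro r hr
      have h3 : HasDerivAt (fun r : ℝ => r - r ^ 2 / R) (1 - 2 * r / R) r := by
        have h4 := (hasDerivAt_id r).sub ((hasDerivAt_pow 2 r).div_const R)
        simp only [Nat.cast_ofNat, Nat.add_one_sub_one, pow_one] at h4
        exact h4
      have h5 := h3.mul ((hder r hr).pow 4)
      simp only [Nat.cast_ofNat, Nat.add_one_sub_one, Pi.pow_apply] at h5
      exact h5
    · apply ContinuousOn.intervalIntegrable_of_Icc hR.le
      fun_prop (disch := simp [hR.ne'])
  have hle : ∫ r in Set.Ioc (0:ℝ) R, (-(a * b / 2)) * ((1 - 2 * r / R) * u r ^ 4 +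
      (r - r ^ 2 / R) * (4 * u r ^ 3 * g r)) = 0 := by
    rw [integral_const_mul, ← intervalIntegral.integral_of_le hR.le, hF, mul_zero]
  refine hle.symm.trans_le ?_
  have hcong : Set.EqOn (fun r : ℝ => r * (a ^ 2 * N r ^ 2
        + b ^ 2 * u r ^ 6 - a * b * ((1 / (2 * r) - 1 / R) * u r ^ 4)))
      (fun r => r * (a ^ 2 * N r ^ 2
        + b ^ 2 * u r ^ 6) - a * b * ((1 / 2 - r / R) * u r ^ 4)) (Set.Ioc 0 R) := by
    intro r hr
    have := hr.1
    dsimp only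
    field_simp
  rw [setIntegral_congr_fun measurableSet_Ioc hcong]
  refine setIntegral_mono_on ?_ ?_ measurableSet_Ioc ?_
  · refine IntegrableOn.mono_set (ContinuousOn.integrableOn_Icc ?_) Set.Ioc_subset_Icc_self
    fun_prop (disch := simp [hR.ne'])
  · refine IntegrableOn.mono_set (ContinuousOn.integrableOn_Icc ?_) Set.Ioc_subset_Icc_self
    fun_prop (disch := simp [hR.ne'])
  · intro r hr
    have hsq := hgN r hr
    generalize g r = g at *
    generalize N r = N at *
    generalize u r = u at *
    obtain ⟨t, ht⟩ : ∃ t, t = r / R := ⟨_, rfl⟩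
    have ht0 : 0 ≤ t := ht ▸ (div_nonneg hr.1.le hR.le)
    have ht1 : t ≤ 1 := ht ▸ (div_le_one_of_le₀ hr.2 hR.le)
    have e1 : 2 * r / R = 2 * t := by rw [ht]; ring
    have e2 : r ^ 2 / R = r * t := by rw [ht]; ring
    rw [e1, e2, ← ht]
    have k1 : 0 ≤ r * (a * g + b * u ^ 3 * (1 - t)) ^ 2 := mul_nonneg hr.1.le (sq_nonneg _)
    have k2 : 0 ≤ r * (a ^ 2 * (N ^ 2 - g ^ 2)) :=
      mul_nonneg hr.1.le (mul_nonneg (sq_nonneg _) (by linarith))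
    have k3 : 0 ≤ r * ((b * u ^ 3) ^ 2 * (t * (2 - t))) :=
      mul_nonneg hr.1.le (mul_nonneg (sq_nonneg _) (mul_nonneg ht0 (by linarith)))
    nlinarith [k1, k2, k3]

lemma radial (R : ℝ) (hR : 0 < R) (a b : ℝ)
    (f : EuclideanSpace ℝ (Fin 2) → ℝ)
    (hf : ContDiffOn ℝ (⊤ : ℕ∞) f (closedBall (0 : EuclideanSpace ℝ (Fin 2)) R))
    (w : EuclideanSpace ℝ (Fin 2)) (hw : ‖w‖ = 1) :
    0 ≤ ∫ r in Set.Ioc (0:ℝ) R, r *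
      (a ^ 2 * ‖fderivWithin ℝ f (closedBall (0 : EuclideanSpace ℝ (Fin 2)) R) (r • w)‖ ^ 2
        + b ^ 2 * f (r • w) ^ 6 - a * b * ((1 / (2 * ‖r • w‖) - 1 / R) * f (r • w) ^ 4)) := by
  set B := closedBall (0 : EuclideanSpace ℝ (Fin 2)) R with hB
  have hu : UniqueDiffOn ℝ B := by
    refine uniqueDiffOn_convex (convex_closedBall _ _) ⟨0, ?_⟩
    exact ball_subset_interior_closedBall (mem_ball_self hR)
  have hD : ContinuousOn (fderivWithin ℝ f B) B := hf.continuousOn_fderivWithin hu (by simp)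
  have hmaps : Set.MapsTo (fun r : ℝ => r • w) (Set.Icc 0 R) B := by
    intro r hr
    simp [hB, norm_smul, hw, abs_of_nonneg hr.1, hr.2]
  have hcw : ContinuousOn (fun r : ℝ => r • w) (Set.Icc 0 R) := by fun_prop
  have hDc : ContinuousOn (fun r : ℝ => fderivWithin ℝ f B (r • w)) (Set.Icc 0 R) :=
    hD.comp hcw hmaps
  have hfc : ContinuousOn (fun r : ℝ => f (r • w)) (Set.Icc 0 R) :=
    hf.continuousOn.comp hcw hmaps
  have hgc : ContinuousOn (fun r : ℝ => fderivWithin ℝ f B (r • w) w) (Set.Icc 0 R) :=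
    hDc.clm_apply continuousOn_const
  have hder : ∀ r ∈ Set.Ioo 0 R, HasDerivAt (fun r : ℝ => f (r • w))
      (fderivWithin ℝ f B (r • w) w) r := by
    intro r hr
    have hn : B ∈ nhds (r • w) := by
      refine Filter.mem_of_superset (isOpen_ball.mem_nhds (x := r • w) ?_) ball_subset_closedBall
      simp [norm_smul, hw, abs_of_pos hr.1, hr.2]
    have h1 : HasFDerivAt f (fderivWithin ℝ f B (r • w)) (r • w) :=
      ((hf.differentiableOn (by simp) _ (mem_of_mem_nhds hn)).hasFDerivWithinAt).hasFDerivAt hn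
    have h2 : HasDerivAt (fun r : ℝ => r • w) w r := by
      simpa using (hasDerivAt_id r).smul_const w
    exact h1.comp_hasDerivAt r h2
  refine (oneD R hR a b (fun r => f (r • w)) (fun r => fderivWithin ℝ f B (r • w) w)
    (fun r => ‖fderivWithin ℝ f B (r • w)‖) hfc hgc hDc.norm hder ?_).trans_eq ?_
  · intro r hr
    have hop : |fderivWithin ℝ f B (r • w) w| ≤ ‖fderivWithin ℝ f B (r • w)‖ := by
      simpa [hw] using (fderivWithin ℝ f B (r • w)).le_opNorm w
    rw [← sq_abs]; gcongr
  · refine setIntegral_congr_fun measurableSet_Ioc fun r hr => ?_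
    simp only [norm_smul, hw, Real.norm_of_nonneg hr.1.le, mul_one]


/-- **Coulomb uncertainty principle in two dimensions.** For any smooth function `f`
on the closed disk `D_R` of radius `R` and all `a, b ∈ ℝ`,
`a²∫_{D_R}|∇f|² + b²∫_{D_R}f⁶ ≥ ab ∫_{D_R} (1/(2|x|) - 1/R) f⁴`. -/
theorem coulomb_uncertainty_two_dim
    (R : ℝ) (hR : 0 < R) (a b : ℝ)
    (f : EuclideanSpace ℝ (Fin 2) → ℝ)
    (hf : ContDiffOn ℝ (⊤ : ℕ∞) f (closedBall (0 : EuclideanSpace ℝ (Fin 2)) R)) :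
    a ^ 2 * (∫ x in closedBall (0 : EuclideanSpace ℝ (Fin 2)) R,
        ‖fderivWithin ℝ f (closedBall (0 : EuclideanSpace ℝ (Fin 2)) R) x‖ ^ 2)
      + b ^ 2 * (∫ x in closedBall (0 : EuclideanSpace ℝ (Fin 2)) R, f x ^ 6)
    ≥ a * b * ∫ x in closedBall (0 : EuclideanSpace ℝ (Fin 2)) R,
        (1 / (2 * ‖x‖) - 1 / R) * f x ^ 4 := by
  set B := closedBall (0 : EuclideanSpace ℝ (Fin 2)) R with hB
  have hu : UniqueDiffOn ℝ B := by
    refine uniqueDiffOn_convex (convex_closedBall _ _) ⟨0, ?_⟩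
    exact ball_subset_interior_closedBall (mem_ball_self hR)
  have hD : ContinuousOn (fderivWithin ℝ f B) B := hf.continuousOn_fderivWithin hu (by simp)
  have hc : ContinuousOn f B := hf.continuousOn
  have hK : IsCompact B := isCompact_closedBall _ _
  have i1 : IntegrableOn (fun x => ‖fderivWithin ℝ f B x‖ ^ 2) B :=
    ContinuousOn.integrableOn_compact hK (by fun_prop)
  have i2 : IntegrableOn (fun x => f x ^ 6) B :=
    ContinuousOn.integrableOn_compact hK (by fun_prop)
  by_cases i3 : IntegrableOn (fun x => (1 / (2 * ‖x‖) - 1 / R) * f x ^ 4) B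
  · have i12 : IntegrableOn (fun x => a ^ 2 * ‖fderivWithin ℝ f B x‖ ^ 2 + b ^ 2 * f x ^ 6) B :=
      (i1.const_mul _).add (i2.const_mul _)
    rw [ge_iff_le, ← sub_nonneg, ← integral_const_mul, ← integral_const_mul, ← integral_const_mul,
      ← integral_add (i1.const_mul _) (i2.const_mul _),
      ← integral_sub i12 (i3.const_mul _),
      ← integral_indicator isClosed_closedBall.measurableSet]
    apply polar_nonneg
    intro w hw
    refine (radial R hR a b f hf w hw).trans_eq ?_
    rw [← integral_indicator measurableSet_Ioc, ← integral_indicator measurableSet_Ioi]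
    congr 1
    ext r
    by_cases h0 : 0 < r
    · by_cases h1 : r ≤ R
      · have : r • w ∈ B := by simp [hB, norm_smul, hw, abs_of_pos h0, h1]
        simp [Set.indicator, h0, h1, this, ← hB]
      · have : r • w ∉ B := by simpa [hB, norm_smul, hw, abs_of_pos h0] using h1
        rw [Set.indicator_of_notMem (fun h => h1 h.2)]
        simp only [Set.indicator, ← hB, if_neg this, mul_zero, ite_self]
    · simp [Set.indicator, h0]
  · rw [integral_undef i3, mul_zero]
    have := integral_nonneg (μ := volume.restrict B)
      (f := fun x => ‖fderivWithin ℝ f B x‖ ^ 2) (fun x => by positivity)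
    have := integral_nonneg (μ := volume.restrict B)
      (f := fun x => f x ^ 6) (fun x => by positivity)
    positivity
end

section
/- Let R > 0 and let u : [0, R] → ℝ be a sufficiently smooth function with u(R) = 0, and let f be a smooth real-valued function on the closed disk D_R ⊂ ℝ² such that all integrals below are finite. Then |∫_{D_R} (2u(|x|) + |x| u'(|x|)) f(x)⁴ dx| ≤ 4 (∫_{D_R} |∇f(x)|² dx)^{1/2} (∫_{D_R} u(|x|)² |x|² f(x)⁶ dx)^{1/2}. -/
open MeasureTheory Metric

lemma aux_polar (G : EuclideanSpace ℝ (Fin 2) → ℝ) (hG : Integrable G)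
    (h : ∀ w : EuclideanSpace ℝ (Fin 2), ‖w‖ = 1 →
      ∫ r in Set.Ioi (0 : ℝ), r * G (r • w) = 0) : ∫ x, G x = 0 := by
  have hd : Module.finrank ℝ (EuclideanSpace ℝ (Fin 2)) - 1 = 1 := by simp
  have hmp := (volume : Measure (EuclideanSpace ℝ (Fin 2))).measurePreserving_homeomorphUnitSphereProd
  rw [hd] at hmp
  set K : sphere (0 : EuclideanSpace ℝ (Fin 2)) 1 × Set.Ioi (0 : ℝ) → ℝ :=
    fun p => G (p.2.1 • p.1.1) with hK
  have hKc : ∀ x : ({0}ᶜ : Set (EuclideanSpace ℝ (Fin 2))),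
      K (homeomorphUnitSphereProd _ x) = G x.1 := by
    intro x
    have hx : ‖x.1‖ ≠ 0 := norm_ne_zero_iff.2 x.2
    simp [hK, smul_smul, hx]
  have e1 : ∫ x, G x = ∫ x : ({0}ᶜ : Set (EuclideanSpace ℝ (Fin 2))), G x.1
      ∂((volume : Measure (EuclideanSpace ℝ (Fin 2))).comap (↑)) := by
    rw [integral_subtype_comap (measurableSet_singleton _).compl G, restrict_compl_singleton]
  have e2 := hmp.integral_comp (Homeomorph.measurableEmbedding _) K
  have i2 := hmp.integrable_comp_emb (g := K) (Homeomorph.measurableEmbedding _)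
  have i1 : Integrable (K ∘ homeomorphUnitSphereProd _)
      ((volume : Measure (EuclideanSpace ℝ (Fin 2))).comap (↑)) := by
    have : IntegrableOn G ({0}ᶜ : Set (EuclideanSpace ℝ (Fin 2))) := hG.integrableOn
    rw [integrableOn_iff_comap_subtypeVal (measurableSet_singleton _).compl] at this
    refine this.congr (.of_forall fun x => ?_)
    simp only [Function.comp]
    exact (hKc x).symm
  have i3 := i2.1 i1
  simp only [hKc] at e2
  rw [e1, e2, integral_prod _ i3]
  have : ∀ w : sphere (0 : EuclideanSpace ℝ (Fin 2)) 1,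
      ∫ r, K (w, r) ∂(Measure.volumeIoiPow 1) = 0 := by
    intro w
    simp only [Measure.volumeIoiPow, ENNReal.ofReal]
    rw [integral_withDensity_eq_integral_smul
      (measurable_subtype_coe.pow_const _).real_toNNReal,
      integral_subtype_comap measurableSet_Ioi
        fun a : ℝ ↦ Real.toNNReal (a ^ 1) • G (a • w.1)]
    refine Eq.trans ?_ (h w.1 (by simp))
    refine setIntegral_congr_fun measurableSet_Ioi fun x hx => ?_
    have hx' : (0:ℝ) ≤ x := le_of_lt hx
    simp [NNReal.smul_def, hx']
  simp [this]

lemma aux_cs {α : Type*} [MeasurableSpace α] (μ : Measure α) (F g h : α → ℝ)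
    (hg0 : ∀ x, 0 ≤ g x) (hh0 : ∀ x, 0 ≤ h x)
    (hgm : AEStronglyMeasurable g μ) (hhm : AEStronglyMeasurable h μ)
    (hg : Integrable (fun x => g x ^ 2) μ) (hh : Integrable (fun x => h x ^ 2) μ)
    (hF : ∀ᵐ x ∂μ, |F x| ≤ g x * h x) :
    |∫ x, F x ∂μ| ≤ Real.sqrt (∫ x, g x ^ 2 ∂μ) * Real.sqrt (∫ x, h x ^ 2 ∂μ) := by
  have mg := (memLp_two_iff_integrable_sq hgm).2 hg
  have mh := (memLp_two_iff_integrable_sq hhm).2 hh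
  have h1 : |∫ x, F x ∂μ| ≤ ∫ x, g x * h x ∂μ := by
    have := norm_integral_le_of_norm_le (f := F) (mg.integrable_mul mh) hF
    simpa using this
  refine h1.trans ?_
  have := integral_mul_le_Lp_mul_Lq_of_nonneg (μ := μ) (p := 2) (q := 2) (f := g) (g := h)
    ⟨by norm_num, by norm_num, by norm_num⟩ (.of_forall hg0) (.of_forall hh0)
    (by simpa using mg) (by simpa using mh)
  simpa [Real.sqrt_eq_rpow] using this

lemma aux_radial (R : ℝ) (hR : 0 < R)
    (u : ℝ → ℝ) (hu : ContDiffOn ℝ (⊤ : ℕ∞) u (Set.Icc 0 R)) (huR : u R = 0)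
    (f : EuclideanSpace ℝ (Fin 2) → ℝ)
    (hf : ContDiffOn ℝ (⊤ : ℕ∞) f (closedBall (0 : EuclideanSpace ℝ (Fin 2)) R))
    (G : EuclideanSpace ℝ (Fin 2) → ℝ)
    (hG : G = fun x => (2 * u ‖x‖ + ‖x‖ * derivWithin u (Set.Icc 0 R) ‖x‖) * f x ^ 4
      + 4 * (u ‖x‖ * f x ^ 3 *
        fderivWithin ℝ f (closedBall (0 : EuclideanSpace ℝ (Fin 2)) R) x x))
    (hGc : ContinuousOn G (closedBall 0 R))
    (w : EuclideanSpace ℝ (Fin 2)) (hw : ‖w‖ = 1) :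
    ∫ r in Set.Ioi (0 : ℝ), r * (closedBall 0 R).indicator G (r • w) = 0 := by
  have hmem : ∀ r ∈ Set.Icc 0 R, r • w ∈ closedBall (0 : EuclideanSpace ℝ (Fin 2)) R := by
    intro r hr
    simpa [norm_smul, hw, abs_of_nonneg hr.1] using hr.2
  have hcw : Continuous fun r : ℝ => r • w := by fun_prop
  have e1 : ∫ r in Set.Ioi (0 : ℝ), r * (closedBall 0 R).indicator G (r • w)
      = ∫ r in (0:ℝ)..R, r * G (r • w) := by
    rw [intervalIntegral.integral_of_le hR.le, ← integral_indicator measurableSet_Ioi,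
      ← integral_indicator measurableSet_Ioc]
    congr 1
    ext r
    by_cases h0 : 0 < r
    · by_cases h1 : r ≤ R
      · have := hmem r ⟨h0.le, h1⟩
        simp only [Set.indicator, Set.mem_Ioi, h0, Set.mem_Ioc, h1, this, if_true, and_self]
      · have : r • w ∉ closedBall (0 : EuclideanSpace ℝ (Fin 2)) R := by
          simpa [norm_smul, hw, abs_of_pos h0] using h1
        simp only [Set.indicator, Set.mem_Ioi, h0, Set.mem_Ioc, h1, this, if_true, and_false,
          if_false, mul_zero]
    · simp [Set.indicator, h0]
  rw [e1]
  have hcf : ContinuousOn (fun r : ℝ => f (r • w)) (Set.Icc 0 R) :=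
    hf.continuousOn.comp hcw.continuousOn hmem
  have key := intervalIntegral.integral_eq_sub_of_hasDerivAt_of_le (a := 0) (b := R)
    (f := fun r => r ^ 2 * u r * f (r • w) ^ 4) (f' := fun r => r * G (r • w)) hR.le
    (((continuousOn_id.pow 2).mul hu.continuousOn).mul (hcf.pow 4)) ?_ ?_
  · rw [key]; simp [huR]
  · intro r hr
    have hru : HasDerivAt u (derivWithin u (Set.Icc 0 R) r) r :=
      ((hu.differentiableOn (by simp)) r ⟨hr.1.le, hr.2.le⟩).hasDerivWithinAt.hasDerivAt
        (Icc_mem_nhds hr.1 hr.2)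
    have hball : closedBall (0 : EuclideanSpace ℝ (Fin 2)) R ∈ nhds (r • w) := by
      refine Filter.mem_of_superset (isOpen_ball.mem_nhds ?_) ball_subset_closedBall
      simpa [norm_smul, hw, abs_of_pos hr.1] using hr.2
    have hrf : HasFDerivAt f (fderivWithin ℝ f (closedBall 0 R) (r • w)) (r • w) :=
      ((hf.differentiableOn (by simp)) _ (hmem r ⟨hr.1.le, hr.2.le⟩)).hasFDerivWithinAt.hasFDerivAt
        hball
    have hs : HasDerivAt (fun r : ℝ => r • w) w r := by
      simpa using (hasDerivAt_id r).smul_const w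
    have hfw := hrf.comp_hasDerivAt r hs
    have hd := (((hasDerivAt_id r).pow 2).mul hru).mul (hfw.pow 4)
    refine (hd.congr_deriv ?_)
    simp only [hG, norm_smul, hw, Real.norm_eq_abs, abs_of_pos hr.1, map_smul, smul_eq_mul, mul_one,
      Function.comp, Pi.mul_apply, Pi.pow_apply, id]
    push_cast
    ring
  · refine ContinuousOn.intervalIntegrable ?_
    rw [Set.uIcc_of_le hR.le]
    exact continuousOn_id.mul (hGc.comp hcw.continuousOn hmem)

/-- **Uncertainty principle lemma.** For `u` smooth on `[0,R]` with `u(R) = 0` and `f`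
smooth on the closed disk `D_R ⊂ ℝ²` (all integrals below being finite),
`|∫_{D_R} (2u(|x|) + |x|u'(|x|)) f⁴| ≤ 4 (∫_{D_R}|∇f|²)^{1/2} (∫_{D_R} u(|x|)²|x|²f⁶)^{1/2}`. -/
theorem uncertainty_principle_lemma_two_dim
    (R : ℝ) (hR : 0 < R)
    (u : ℝ → ℝ) (hu : ContDiffOn ℝ (⊤ : ℕ∞) u (Set.Icc 0 R)) (huR : u R = 0)
    (f : EuclideanSpace ℝ (Fin 2) → ℝ)
    (hf : ContDiffOn ℝ (⊤ : ℕ∞) f (closedBall (0 : EuclideanSpace ℝ (Fin 2)) R))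
    (h1 : IntegrableOn
      (fun x => (2 * u ‖x‖ + ‖x‖ * derivWithin u (Set.Icc 0 R) ‖x‖) * f x ^ 4)
      (closedBall (0 : EuclideanSpace ℝ (Fin 2)) R))
    (h2 : IntegrableOn
      (fun x => ‖fderivWithin ℝ f (closedBall (0 : EuclideanSpace ℝ (Fin 2)) R) x‖ ^ 2)
      (closedBall (0 : EuclideanSpace ℝ (Fin 2)) R))
    (h3 : IntegrableOn (fun x => u ‖x‖ ^ 2 * ‖x‖ ^ 2 * f x ^ 6)
      (closedBall (0 : EuclideanSpace ℝ (Fin 2)) R)) :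
    |∫ x in closedBall (0 : EuclideanSpace ℝ (Fin 2)) R,
        (2 * u ‖x‖ + ‖x‖ * derivWithin u (Set.Icc 0 R) ‖x‖) * f x ^ 4|
      ≤ 4 * Real.sqrt (∫ x in closedBall (0 : EuclideanSpace ℝ (Fin 2)) R,
            ‖fderivWithin ℝ f (closedBall (0 : EuclideanSpace ℝ (Fin 2)) R) x‖ ^ 2)
          * Real.sqrt (∫ x in closedBall (0 : EuclideanSpace ℝ (Fin 2)) R,
            u ‖x‖ ^ 2 * ‖x‖ ^ 2 * f x ^ 6) := by
  have hUD : UniqueDiffOn ℝ (closedBall (0 : EuclideanSpace ℝ (Fin 2)) R) :=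
    uniqueDiffOn_convex (convex_closedBall _ _)
      ⟨0, ball_subset_interior_closedBall (by simpa using hR)⟩
  have hmaps : Set.MapsTo (fun x : EuclideanSpace ℝ (Fin 2) => ‖x‖) (closedBall 0 R)
      (Set.Icc 0 R) := fun x hx => ⟨norm_nonneg x, by simpa using hx⟩
  have hcn : ContinuousOn (fun x : EuclideanSpace ℝ (Fin 2) => ‖x‖) (closedBall 0 R) :=
    continuous_norm.continuousOn
  have cu : ContinuousOn (fun x : EuclideanSpace ℝ (Fin 2) => u ‖x‖) (closedBall 0 R) :=
    hu.continuousOn.comp hcn hmaps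
  have cu' : ContinuousOn (fun x : EuclideanSpace ℝ (Fin 2) =>
      derivWithin u (Set.Icc 0 R) ‖x‖) (closedBall 0 R) :=
    (hu.continuousOn_derivWithin (uniqueDiffOn_Icc hR) (by simp)).comp hcn hmaps
  have cf := hf.continuousOn
  have cf' := hf.continuousOn_fderivWithin hUD (by simp)
  have cF : ContinuousOn (fun x => u ‖x‖ * f x ^ 3 *
      fderivWithin ℝ f (closedBall (0 : EuclideanSpace ℝ (Fin 2)) R) x x) (closedBall 0 R) :=
    (cu.mul (cf.pow 3)).mul (cf'.clm_apply continuousOn_id)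
  have cA : ContinuousOn (fun x => (2 * u ‖x‖ + ‖x‖ * derivWithin u (Set.Icc 0 R) ‖x‖) * f x ^ 4)
      (closedBall (0 : EuclideanSpace ℝ (Fin 2)) R) :=
    ((continuousOn_const.mul cu).add (hcn.mul cu')).mul (cf.pow 4)
  have hK : IsCompact (closedBall (0 : EuclideanSpace ℝ (Fin 2)) R) := isCompact_closedBall _ _
  have hM : MeasurableSet (closedBall (0 : EuclideanSpace ℝ (Fin 2)) R) := measurableSet_closedBall
  have iF := cF.integrableOn_compact (μ := volume) hK
  have cG := cA.add (continuousOn_const.mul cF : ContinuousOn (fun x => (4:ℝ) * _) _)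
  have iG := cG.integrableOn_compact (μ := volume) hK
  have hz := aux_polar _ ((integrable_indicator_iff hM).2 iG)
    (aux_radial R hR u hu huR f hf _ rfl cG)
  rw [integral_indicator hM] at hz
  have hz2 : (∫ x in closedBall (0 : EuclideanSpace ℝ (Fin 2)) R,
        (2 * u ‖x‖ + ‖x‖ * derivWithin u (Set.Icc 0 R) ‖x‖) * f x ^ 4)
      + 4 * ∫ x in closedBall (0 : EuclideanSpace ℝ (Fin 2)) R, u ‖x‖ * f x ^ 3 *
        fderivWithin ℝ f (closedBall (0 : EuclideanSpace ℝ (Fin 2)) R) x x = 0 := by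
    rw [← integral_const_mul, ← integral_add h1 (iF.const_mul 4)]
    exact hz
  have e3 : ∀ x : EuclideanSpace ℝ (Fin 2),
      (|u ‖x‖| * ‖x‖ * |f x| ^ 3) ^ 2 = u ‖x‖ ^ 2 * ‖x‖ ^ 2 * f x ^ 6 := by
    intro x
    rw [mul_pow, mul_pow, sq_abs, ← pow_mul, mul_comm 3 2, pow_mul, sq_abs]
    ring
  have cs := aux_cs (volume.restrict (closedBall (0 : EuclideanSpace ℝ (Fin 2)) R))
    (fun x => u ‖x‖ * f x ^ 3 *
        fderivWithin ℝ f (closedBall (0 : EuclideanSpace ℝ (Fin 2)) R) x x)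
    (fun x => ‖fderivWithin ℝ f (closedBall (0 : EuclideanSpace ℝ (Fin 2)) R) x‖)
    (fun x => |u ‖x‖| * ‖x‖ * |f x| ^ 3)
    (fun x => norm_nonneg _) (fun x => by positivity)
    (cf'.norm.aestronglyMeasurable hM)
    (((cu.abs.mul hcn).mul (cf.abs.pow 3)).aestronglyMeasurable hM)
    h2 (by simp only [e3]; exact h3) (.of_forall fun x => by
      rw [abs_mul, abs_mul, abs_pow]
      have := (fderivWithin ℝ f (closedBall (0 : EuclideanSpace ℝ (Fin 2)) R) x).le_opNorm x
      rw [Real.norm_eq_abs] at this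
      calc _ ≤ |u ‖x‖| * |f x| ^ 3 *
            (‖fderivWithin ℝ f (closedBall (0 : EuclideanSpace ℝ (Fin 2)) R) x‖ * ‖x‖) := by
            gcongr
        _ = _ := by ring)
  simp only [e3] at cs
  rw [eq_neg_of_add_eq_zero_left hz2, abs_neg, abs_mul, abs_of_pos (by norm_num : (0:ℝ) < 4),
    mul_assoc]
  exact mul_le_mul_of_nonneg_left cs (by norm_num)
end

section
/- Let R > 0, let u : [0, R] → ℝ be smooth with u(R) = 0, and let f be a smooth positive function on the closed disk D_R ⊂ ℝ² of the form f(x)² = 1/(λ ∫₀^{|x|} s u(s) ds + C) for some constants λ and C with the denominator positive on [0,R]. Then equality holds in the uncertainty principle: |∫_{D_R} (2u(|x|) + |x| u'(|x|)) f(x)⁴ dx| = 4 (∫_{D_R} |∇f(x)|² dx)^{1/2} (∫_{D_R} u(|x|)² |x|² f(x)⁶ dx)^{1/2}. -/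
open MeasureTheory Metric

theorem aux_radial_s4 (R : ℝ) (hR : 0 < R) (g : ℝ → ℝ) :
    ∫ x in closedBall (0 : EuclideanSpace ℝ (Fin 2)) R, g ‖x‖
      = (2 * (volume : Measure (EuclideanSpace ℝ (Fin 2))).real (ball 0 1))
        * ∫ y in (0 : ℝ)..R, y * g y := by
  have h := integral_fun_norm_addHaar (volume : Measure (EuclideanSpace ℝ (Fin 2)))
    ((Set.Iic R).indicator g)
  have h1 : ∫ x in closedBall (0 : EuclideanSpace ℝ (Fin 2)) R, g ‖x‖
      = ∫ x : EuclideanSpace ℝ (Fin 2), (Set.Iic R).indicator g ‖x‖ := by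
    rw [← integral_indicator measurableSet_closedBall]
    congr 1
    ext x
    simp [Set.indicator]
  rw [h1, h, intervalIntegral.integral_of_le hR.le]
  have h2 : ∫ y in Set.Ioi (0 : ℝ), y ^ (Module.finrank ℝ (EuclideanSpace ℝ (Fin 2)) - 1) •
      (Set.Iic R).indicator g y = ∫ y in Set.Ioc 0 R, y * g y := by
    rw [← Set.Ioi_inter_Iic, ← setIntegral_indicator measurableSet_Iic]
    congr 1
    ext y
    by_cases hy : y ≤ R <;> simp [Set.indicator, hy]
  rw [h2]
  simp [mul_assoc]

theorem aux_phi (R : ℝ) (u : ℝ → ℝ) (hu : ContinuousOn u (Set.Icc 0 R)) (l C r : ℝ)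
    (hr : r ∈ Set.Ioo 0 R) :
    HasDerivAt (fun r => l * (∫ s in (0 : ℝ)..r, s * u s) + C) (l * (r * u r)) r := by
  have hc : ContinuousOn (fun s => s * u s) (Set.Icc 0 R) := continuousOn_id.mul hu
  refine HasDerivAt.add_const _ (HasDerivAt.const_mul _ ?_)
  have hn : Set.Icc 0 R ∈ nhds r := Icc_mem_nhds hr.1 hr.2
  refine intervalIntegral.integral_hasDerivAt_right ?_ ?_ (hc.continuousAt hn)
  · apply ContinuousOn.intervalIntegrable
    rw [Set.uIcc_of_le hr.1.le]
    exact hc.mono (Set.Icc_subset_Icc_right hr.2.le)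
  · exact (hc.mono Set.Ioo_subset_Icc_self).stronglyMeasurableAtFilter isOpen_Ioo r hr

theorem aux_phi_cont (R : ℝ) (hR : 0 < R) (u : ℝ → ℝ) (hu : ContinuousOn u (Set.Icc 0 R))
    (l C : ℝ) :
    ContinuousOn (fun r => l * (∫ s in (0 : ℝ)..r, s * u s) + C) (Set.Icc 0 R) := by
  have hc : ContinuousOn (fun s => s * u s) (Set.Icc 0 R) := continuousOn_id.mul hu
  have := intervalIntegral.continuousOn_primitive_interval (μ := volume) (a := 0) (b := R)
    (f := fun s => s * u s) (by rw [Set.uIcc_of_le hR.le]; exact hc.integrableOn_Icc)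
  rw [Set.uIcc_of_le hR.le] at this
  exact (this.const_mul l).add continuousOn_const

theorem aux_1d (R : ℝ) (hR : 0 < R)
    (u : ℝ → ℝ) (hu : ContDiffOn ℝ (⊤ : ℕ∞) u (Set.Icc 0 R)) (huR : u R = 0)
    (l : ℝ) (p : ℝ → ℝ) (hp : ∀ r ∈ Set.Icc (0 : ℝ) R, 0 < p r)
    (hpc : ContinuousOn p (Set.Icc 0 R))
    (hpd : ∀ r ∈ Set.Ioo 0 R, HasDerivAt p (l * (r * u r)) r) :
    ∫ y in (0 : ℝ)..R, y * ((2 * u y + y * derivWithin u (Set.Icc 0 R) y) * (p y)⁻¹ ^ 2)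
      = 2 * l * ∫ y in (0 : ℝ)..R, y * (u y ^ 2 * y ^ 2 * (p y)⁻¹ ^ 3) := by
  have huc := hu.continuousOn
  have hud : ContinuousOn (derivWithin u (Set.Icc 0 R)) (Set.Icc 0 R) :=
    hu.continuousOn_derivWithin (uniqueDiffOn_Icc hR) (by norm_num)
  have hpi : ContinuousOn (fun y => (p y)⁻¹) (Set.Icc 0 R) :=
    hpc.inv₀ fun r hr => (hp r hr).ne'
  have hA : ContinuousOn (fun y => y * ((2 * u y + y * derivWithin u (Set.Icc 0 R) y)
      * (p y)⁻¹ ^ 2)) (Set.Icc 0 R) := by fun_prop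
  have hB : ContinuousOn (fun y => y * (u y ^ 2 * y ^ 2 * (p y)⁻¹ ^ 3)) (Set.Icc 0 R) := by
    fun_prop
  have hA' : IntervalIntegrable (fun y => y * ((2 * u y + y * derivWithin u (Set.Icc 0 R) y)
      * (p y)⁻¹ ^ 2)) volume 0 R := hA.intervalIntegrable_of_Icc hR.le
  have hB' : IntervalIntegrable (fun y => y * (u y ^ 2 * y ^ 2 * (p y)⁻¹ ^ 3)) volume 0 R :=
    hB.intervalIntegrable_of_Icc hR.le
  have key := intervalIntegral.integral_eq_sub_of_hasDerivAt_of_le (a := 0) (b := R) hR.le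
    (f := fun y => y ^ 2 * u y * (p y)⁻¹ ^ 2)
    (f' := fun y => y * ((2 * u y + y * derivWithin u (Set.Icc 0 R) y) * (p y)⁻¹ ^ 2)
      - 2 * l * (y * (u y ^ 2 * y ^ 2 * (p y)⁻¹ ^ 3)))
    (by fun_prop) (by
      intro y hy
      have hd : HasDerivAt u (derivWithin u (Set.Icc 0 R) y) y :=
        ((hu.differentiableOn (by norm_num)) y
          (Set.Ioo_subset_Icc_self hy)).hasDerivWithinAt.hasDerivAt (Icc_mem_nhds hy.1 hy.2)
      have hpy := (hp y (Set.Ioo_subset_Icc_self hy)).ne'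
      have := (((hasDerivAt_id y).pow 2).mul hd).mul (((hpd y hy).inv hpy).pow 2)
      refine this.congr_deriv ?_
      simp
      field_simp
      ring)
    (hA'.sub (hB'.const_mul _))
  rw [intervalIntegral.integral_sub hA' (hB'.const_mul _),
    intervalIntegral.integral_const_mul] at key
  simp [huR] at key
  simp
  linarith

theorem aux_grad (R : ℝ) (u : ℝ → ℝ) (l : ℝ) (p : ℝ → ℝ)
    (hp : ∀ r ∈ Set.Icc (0 : ℝ) R, 0 < p r)
    (hpd : ∀ r ∈ Set.Ioo 0 R, HasDerivAt p (l * (r * u r)) r)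
    (f : EuclideanSpace ℝ (Fin 2) → ℝ)
    (hfpos : ∀ x ∈ closedBall (0 : EuclideanSpace ℝ (Fin 2)) R, 0 < f x)
    (hform : ∀ x ∈ closedBall (0 : EuclideanSpace ℝ (Fin 2)) R, f x ^ 2 = (p ‖x‖)⁻¹)
    (x : EuclideanSpace ℝ (Fin 2)) (hx0 : x ≠ 0) (hx : x ∈ ball 0 R) :
    ‖fderivWithin ℝ f (closedBall (0 : EuclideanSpace ℝ (Fin 2)) R) x‖ ^ 2
      = l ^ 2 / 4 * (u ‖x‖ ^ 2 * ‖x‖ ^ 2 * (p ‖x‖)⁻¹ ^ 3) := by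
  have hn : closedBall (0 : EuclideanSpace ℝ (Fin 2)) R ∈ nhds x :=
    Filter.mem_of_superset (isOpen_ball.mem_nhds hx) ball_subset_closedBall
  have hxn : 0 < ‖x‖ := norm_pos_iff.2 hx0
  have hxI : ‖x‖ ∈ Set.Ioo 0 R := ⟨hxn, by simpa using hx⟩
  have hpx := hp _ (Set.Ioo_subset_Icc_self hxI)
  have hsq : HasFDerivAt (fun y : EuclideanSpace ℝ (Fin 2) => ‖y‖ ^ 2)
      (2 • innerSL ℝ x) x := (hasStrictFDerivAt_norm_sq x).hasFDerivAt
  have hnorm : HasFDerivAt (fun y : EuclideanSpace ℝ (Fin 2) => ‖y‖)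
      ((‖x‖⁻¹) • innerSL ℝ x) x := by
    have := hsq.sqrt (by positivity)
    simp only [Real.sqrt_sq (norm_nonneg _)] at this
    refine this.congr_fderiv ?_
    ext v
    simp
    field_simp
  have hg := ((hpd _ hxI).inv hpx.ne').sqrt (inv_pos.2 hpx).ne'
  have hcomp := hg.comp_hasFDerivAt x hnorm
  have hev : f =ᶠ[nhds x] ((fun r => Real.sqrt ((p r)⁻¹)) ∘ fun y => ‖y‖) := by
    filter_upwards [hn] with y hy
    simp only [Function.comp]
    rw [← hform y hy, Real.sqrt_sq (hfpos y hy).le]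
  rw [fderivWithin_of_mem_nhds hn, (hcomp.congr_of_eventuallyEq hev).fderiv]
  rw [norm_smul, norm_smul, innerSL_apply_norm, mul_pow, mul_pow]
  have hs : Real.sqrt ((p ‖x‖)⁻¹) ^ 2 = (p ‖x‖)⁻¹ := Real.sq_sqrt (inv_pos.2 hpx).le
  have hspos : 0 < Real.sqrt ((p ‖x‖)⁻¹) := Real.sqrt_pos.2 (inv_pos.2 hpx)
  simp only [Real.norm_eq_abs, sq_abs, Pi.inv_apply, div_pow, mul_pow, norm_inv, abs_norm, hs]
  field_simp
  ring

/-- **Equality case of the uncertainty principle.** If `u` is smooth on `[0,R]` with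
`u(R) = 0` and `f` is a smooth positive function on the closed disk of the form
`f(x)² = 1/(λ ∫₀^{|x|} s u(s) ds + C)` (with positive denominator on `[0,R]`), then
equality holds in the uncertainty principle. -/
theorem uncertainty_principle_equality_two_dim
    (R : ℝ) (hR : 0 < R)
    (u : ℝ → ℝ) (hu : ContDiffOn ℝ (⊤ : ℕ∞) u (Set.Icc 0 R)) (huR : u R = 0)
    (f : EuclideanSpace ℝ (Fin 2) → ℝ)
    (hf : ContDiffOn ℝ (⊤ : ℕ∞) f (closedBall (0 : EuclideanSpace ℝ (Fin 2)) R))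
    (hfpos : ∀ x ∈ closedBall (0 : EuclideanSpace ℝ (Fin 2)) R, 0 < f x)
    (l C : ℝ)
    (hden : ∀ r ∈ Set.Icc (0 : ℝ) R, 0 < l * (∫ s in (0 : ℝ)..r, s * u s) + C)
    (hform : ∀ x ∈ closedBall (0 : EuclideanSpace ℝ (Fin 2)) R,
      f x ^ 2 = (l * (∫ s in (0 : ℝ)..‖x‖, s * u s) + C)⁻¹) :
    |∫ x in closedBall (0 : EuclideanSpace ℝ (Fin 2)) R,
        (2 * u ‖x‖ + ‖x‖ * derivWithin u (Set.Icc 0 R) ‖x‖) * f x ^ 4|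
      = 4 * Real.sqrt (∫ x in closedBall (0 : EuclideanSpace ℝ (Fin 2)) R,
            ‖fderivWithin ℝ f (closedBall (0 : EuclideanSpace ℝ (Fin 2)) R) x‖ ^ 2)
          * Real.sqrt (∫ x in closedBall (0 : EuclideanSpace ℝ (Fin 2)) R,
            u ‖x‖ ^ 2 * ‖x‖ ^ 2 * f x ^ 6) := by
  set p : ℝ → ℝ := fun r => l * (∫ s in (0 : ℝ)..r, s * u s) + C with hpdef
  have hpd := aux_phi R u hu.continuousOn l C
  have hpc := aux_phi_cont R hR u hu.continuousOn l C
  have h1d := aux_1d R hR u hu huR l p hden hpc hpd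
  have hI1 : ∫ x in closedBall (0 : EuclideanSpace ℝ (Fin 2)) R,
        (2 * u ‖x‖ + ‖x‖ * derivWithin u (Set.Icc 0 R) ‖x‖) * f x ^ 4
      = ∫ x in closedBall (0 : EuclideanSpace ℝ (Fin 2)) R,
        (fun r => (2 * u r + r * derivWithin u (Set.Icc 0 R) r) * (p r)⁻¹ ^ 2) ‖x‖ := by
    refine setIntegral_congr_fun measurableSet_closedBall fun x hx => ?_
    simp only
    rw [show f x ^ 4 = (f x ^ 2) ^ 2 by ring, hform x hx]
  have hI3 : ∫ x in closedBall (0 : EuclideanSpace ℝ (Fin 2)) R, u ‖x‖ ^ 2 * ‖x‖ ^ 2 * f x ^ 6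
      = ∫ x in closedBall (0 : EuclideanSpace ℝ (Fin 2)) R,
        (fun r => u r ^ 2 * r ^ 2 * (p r)⁻¹ ^ 3) ‖x‖ := by
    refine setIntegral_congr_fun measurableSet_closedBall fun x hx => ?_
    simp only
    rw [show f x ^ 6 = (f x ^ 2) ^ 3 by ring, hform x hx]
  have hI2 : ∫ x in closedBall (0 : EuclideanSpace ℝ (Fin 2)) R,
        ‖fderivWithin ℝ f (closedBall (0 : EuclideanSpace ℝ (Fin 2)) R) x‖ ^ 2
      = l ^ 2 / 4 * ∫ x in closedBall (0 : EuclideanSpace ℝ (Fin 2)) R,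
        (fun r => u r ^ 2 * r ^ 2 * (p r)⁻¹ ^ 3) ‖x‖ := by
    rw [← integral_const_mul]
    refine setIntegral_congr_ae measurableSet_closedBall ?_
    have h0 : ∀ᵐ x : EuclideanSpace ℝ (Fin 2), x ≠ 0 := by
      simp [ae_iff]
    have h1 : ∀ᵐ x : EuclideanSpace ℝ (Fin 2), x ∉ sphere (0 : EuclideanSpace ℝ (Fin 2)) R := by
      rw [ae_iff]
      have h2 := Measure.addHaar_sphere volume (0 : EuclideanSpace ℝ (Fin 2)) R
      simpa only [not_not, Set.setOf_mem_eq] using h2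
    filter_upwards [h0, h1] with x hx0 hx1 hx
    refine aux_grad R u l p hden hpd f hfpos hform x hx0 ?_
    rw [mem_ball]
    exact lt_of_le_of_ne hx hx1
  have hJ : 0 ≤ ∫ x in closedBall (0 : EuclideanSpace ℝ (Fin 2)) R,
        (fun r => u r ^ 2 * r ^ 2 * (p r)⁻¹ ^ 3) ‖x‖ := by
    rw [← hI3]
    refine setIntegral_nonneg measurableSet_closedBall fun x hx => ?_
    have := hfpos x hx
    positivity
  have hL : ∫ x in closedBall (0 : EuclideanSpace ℝ (Fin 2)) R,
        (fun r => (2 * u r + r * derivWithin u (Set.Icc 0 R) r) * (p r)⁻¹ ^ 2) ‖x‖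
      = 2 * l * ∫ x in closedBall (0 : EuclideanSpace ℝ (Fin 2)) R,
        (fun r => u r ^ 2 * r ^ 2 * (p r)⁻¹ ^ 3) ‖x‖ := by
    have e1 := aux_radial_s4 R hR
      (fun r => (2 * u r + r * derivWithin u (Set.Icc 0 R) r) * (p r)⁻¹ ^ 2)
    have e2 := aux_radial_s4 R hR (fun r => u r ^ 2 * r ^ 2 * (p r)⁻¹ ^ 3)
    refine e1.trans ?_
    refine Eq.trans ?_ (congrArg (fun t => 2 * l * t) e2.symm)
    simp only [h1d]
    ring
  rw [hI1, hI2, hI3, hL]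
  generalize (∫ x in closedBall (0 : EuclideanSpace ℝ (Fin 2)) R,
        (fun r => u r ^ 2 * r ^ 2 * (p r)⁻¹ ^ 3) ‖x‖) = J at hJ
  rw [Real.sqrt_mul (by positivity), show l ^ 2 / 4 = (l / 2) ^ 2 by ring, Real.sqrt_sq_eq_abs,
    abs_mul, abs_mul, abs_div, abs_of_nonneg hJ, abs_two]
  have := Real.mul_self_sqrt hJ
  linear_combination (-2 * |l|) * this
end

section
/- Let K ≥ 2, z > 0, and let R₁, …, R_K be distinct points in ℝ² with Voronoi cells Γ_j = {x ∈ ℝ² : |x − R_j| ≤ |x − R_k| for all k} and D_j = (1/2) min_{k ≠ j} |R_k − R_j|. Define Φ on ℝ² piecewise by Φ(x) = Σ_{i ≠ j} z/|x − R_i| for x ∈ Γ_j, and U = Σ_{1 ≤ i < j ≤ K} z²/|R_i − R_j|. Then for every nonnegative ρ ∈ L^{3/2}(ℝ²) (with all terms finite), D(ρ, ρ) − ∫_{ℝ²} Φ(x) ρ(x) dx + U ≥ (z²/8) Σ_{j=1}^K 1/D_j. -/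
open MeasureTheory

namespace LY
open Set Filter Topology Metric Pointwise

abbrev H := EuclideanSpace ℝ (Fin 3)

noncomputable def F (u : H) : H := (‖u‖ ^ 3)⁻¹ • u

lemma norm_F (u : H) : ‖F u‖ = (‖u‖ ^ 2)⁻¹ := by
  unfold F
  rw [norm_smul]
  rcases eq_or_ne u 0 with rfl | h
  · simp
  · have : 0 < ‖u‖ := norm_pos_iff.2 h
    rw [norm_inv, norm_pow, norm_norm]
    field_simp

lemma F_neg (u : H) : F (-u) = -F u := by simp [F]

lemma measurable_F : Measurable F := by
  unfold F
  fun_prop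

lemma ftc (g G : ℝ → ℝ) (L : ℝ) (S : Set ℝ) (hS : S.Countable)
    (hc : ContinuousOn g (Ioi 0)) (hd : ∀ r, 0 < r → r ∉ S → HasDerivAt g (-G r) r)
    (h0 : Tendsto g (𝓝[>] 0) (𝓝 L)) (hinf : Tendsto g atTop (𝓝 0))
    (hi : IntegrableOn G (Ioi 0)) : ∫ r in Ioi (0 : ℝ), G r = L := by
  set a : ℕ → ℝ := fun n => 1 / ((n : ℝ) + 1)
  set b : ℕ → ℝ := fun n => (n : ℝ) + 1
  have ha : Tendsto a atTop (𝓝 0) := tendsto_one_div_add_atTop_nhds_zero_nat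
  have ha' : Tendsto a atTop (𝓝[>] 0) :=
    tendsto_nhdsWithin_iff.2 ⟨ha, Eventually.of_forall fun n => by simp [a]; positivity⟩
  have hb : Tendsto b atTop atTop := tendsto_atTop_add_const_right _ _ tendsto_natCast_atTop_atTop
  have hcov : AECover (volume.restrict (Ioi (0 : ℝ))) atTop fun n => Ioi (a n) ∩ Iic (b n) :=
    (aecover_Ioi_of_Ioi ha).inter ((aecover_Iic hb).mono Measure.restrict_le_self)
  have h1 := hcov.integral_tendsto_of_countably_generated hi
  refine tendsto_nhds_unique h1 ?_
  have h2 : Tendsto (fun n => g (a n) - g (b n)) atTop (𝓝 (L - 0)) :=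
    (h0.comp ha').sub (hinf.comp hb)
  rw [sub_zero] at h2
  refine h2.congr fun n => ?_
  have hap : 0 < a n := by simp [a]; positivity
  have hab : a n ≤ b n := by
    simp only [a, b]
    rw [div_le_iff₀ (by positivity)]
    have : (0:ℝ) ≤ n := by positivity
    nlinarith
  rw [Ioi_inter_Iic, Measure.restrict_restrict measurableSet_Ioc]
  have hsub : Ioc (a n) (b n) ⊆ Ioi 0 := fun x hx => hap.trans hx.1
  rw [inter_eq_left.2 hsub, ← intervalIntegral.integral_of_le hab]
  have := MeasureTheory.integral_eq_of_hasDerivAt_off_countable_of_le g (fun r => - G r) hab hS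
    (hc.mono fun x hx => hap.trans_le hx.1)
    (fun x hx => hd x (hap.trans hx.1.1) hx.2)
    ((intervalIntegrable_iff_integrableOn_Ioc_of_le hab).2 (hi.mono_set hsub).neg)
  rw [intervalIntegral.integral_neg] at this
  linarith

lemma polar (f : H → ℝ) (hf : Integrable f) (x : H) :
    (∀ᵐ ω : sphere (0:H) 1 ∂(volume : Measure H).toSphere,
      IntegrableOn (fun r : ℝ => r ^ 2 * f (x + r • (ω : H))) (Ioi 0)) ∧
    ∫ w, f w = ∫ ω : sphere (0:H) 1, (∫ r in Ioi (0 : ℝ), r ^ 2 * f (x + r • (ω : H)))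
      ∂(volume : Measure H).toSphere := by
  set μ : Measure H := volume
  have hdim : Module.finrank ℝ H - 1 = 2 := by simp
  have mp := μ.measurePreserving_homeomorphUnitSphereProd
  rw [hdim] at mp
  set f' : H → ℝ := fun w => f (x + w)
  have hf' : Integrable f' μ := hf.comp_add_left x
  have e1 : ∫ w, f w = ∫ w, f' w := (integral_add_left_eq_self f x).symm
  set g : sphere (0:H) 1 × Ioi (0:ℝ) → ℝ := fun p => f' (p.2.1 • p.1.1)
  have hg : ∀ w : ({(0:H)}ᶜ : Set H), g (homeomorphUnitSphereProd H w) = f' w := by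
    intro w
    have : (homeomorphUnitSphereProd H).symm (homeomorphUnitSphereProd H w) = w := by simp
    have h2 := congrArg Subtype.val this
    simp only [homeomorphUnitSphereProd_symm_apply_coe] at h2
    simp only [g]
    rw [h2]
  have hgi : Integrable g (μ.toSphere.prod (.volumeIoiPow 2)) := by
    rw [← mp.integrable_comp_emb (Homeomorph.measurableEmbedding _)]
    have : g ∘ homeomorphUnitSphereProd H = f' ∘ Subtype.val := by
      ext w; exact hg w
    rw [this, ← integrableOn_iff_comap_subtypeVal (measurableSet_singleton _).compl]
    exact hf'.integrableOn
  have e2 : ∫ w, f' w ∂μ = ∫ p, g p ∂(μ.toSphere.prod (.volumeIoiPow 2)) := by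
    rw [← mp.integral_comp (Homeomorph.measurableEmbedding _) g]
    simp only [hg]
    rw [integral_subtype_comap (measurableSet_singleton _).compl fun x ↦ f' x,
        restrict_compl_singleton]
  have key : ∀ h : ℝ → ℝ, (Integrable (fun r : Ioi (0:ℝ) => h r) (.volumeIoiPow 2) →
      IntegrableOn (fun r => r ^ 2 * h r) (Ioi 0)) ∧
      ∫ r : Ioi (0:ℝ), h r ∂(.volumeIoiPow 2) = ∫ r in Ioi (0:ℝ), r ^ 2 * h r := by
    intro h
    constructor
    · intro hh
      rw [Measure.volumeIoiPow, integrable_withDensity_iff_integrable_smul'] at hh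
      · rw [integrableOn_iff_comap_subtypeVal measurableSet_Ioi]
        refine hh.congr (.of_forall ?_)
        rintro ⟨r, hr : 0 < r⟩
        simp (disch := positivity) [ENNReal.toReal_ofReal]
      · fun_prop
      · simp
    · simp only [Measure.volumeIoiPow, ENNReal.ofReal]
      rw [integral_withDensity_eq_integral_smul,
        integral_subtype_comap measurableSet_Ioi fun a ↦ Real.toNNReal (a ^ 2) • h a,
        setIntegral_congr_fun measurableSet_Ioi fun x hx ↦ ?_]
      · simp only [NNReal.smul_def]
        rw [Real.coe_toNNReal _ (by positivity), smul_eq_mul]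
      · exact (measurable_subtype_coe.pow_const _).real_toNNReal
  constructor
  · have := hgi.prod_right_ae
    filter_upwards [this] with ω hω
    exact (key (fun r => f' (r • ω.1))).1 hω
  · rw [e1, e2, integral_prod _ hgi]
    refine integral_congr_ae (.of_forall fun ω => ?_)
    exact (key (fun r => f' (r • ω.1))).2

lemma sphere_univ : (volume : Measure H).toSphere.real univ = 4 * Real.pi := by
  rw [Measure.toSphere_real_apply_univ]
  simp [measureReal_def, EuclideanSpace.volume_ball_fin_three]
  rw [ENNReal.toReal_ofReal (by positivity)]
  ring

lemma sphere_ray (x y : H) : ∀ᵐ ω : sphere (0:H) 1 ∂(volume : Measure H).toSphere,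
    ∀ r : ℝ, 0 < r → x + r • (ω : H) ≠ y := by
  have hne : ∀ ω : sphere (0:H) 1, (volume : Measure H).toSphere {ω} = 0 := by
    intro ω
    rw [Measure.toSphere_apply' _ (measurableSet_singleton _)]
    have : volume (Ioo (0:ℝ) 1 • ((fun a : sphere (0:H) 1 => (a:H)) '' {ω})) = 0 := by
      refine measure_mono_null ?_ (Measure.addHaar_submodule volume (Submodule.span ℝ {(ω:H)}) ?_)
      · rintro _ ⟨r, hr, _, ⟨_, rfl, rfl⟩, rfl⟩
        exact Submodule.smul_mem _ _ (Submodule.mem_span_singleton_self _)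
      · intro h
        have h1 := finrank_span_le_card (R := ℝ) ({(ω:H)} : Set H)
        rw [h] at h1
        simp at h1
    exact mul_eq_zero_of_right _ this
  by_cases h : ∃ ω : sphere (0:H) 1, ∃ r : ℝ, 0 < r ∧ x + r • (ω : H) = y
  · obtain ⟨ω, r, hr, h⟩ := h
    have : ∀ᵐ ω' ∂(volume : Measure H).toSphere, ω' ≠ ω := by
      rw [ae_iff]; simpa using hne ω
    filter_upwards [this] with ω' hω' s hs h'
    apply hω'
    have h3 : r • (ω:H) = s • (ω':H) := by
      rw [← h] at h'; exact (add_left_cancel h').symm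
    have n1 : ‖(ω:H)‖ = 1 := by simp
    have n2 : ‖(ω':H)‖ = 1 := by simp
    have h4 : r = s := by
      have := congrArg norm h3
      rwa [norm_smul, norm_smul, n1, n2, Real.norm_of_nonneg hr.le, Real.norm_of_nonneg hs.le, mul_one, mul_one] at this
    subst h4
    exact Subtype.ext (smul_right_injective H hr.ne' h3).symm
  · push Not at h
    exact .of_forall fun ω r hr => h ω r hr

end LY


namespace LY
open Set Filter Topology Metric Pointwise

section vor
variable {ι : Type} [Fintype ι] [LinearOrder ι] [Nonempty ι]

def cell (R : ι → H) (w : H) (i : ι) : Prop :=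
  (∀ k, ‖w - R i‖ ≤ ‖w - R k‖) ∧ ∀ k, k < i → ¬ ‖w - R k‖ ≤ ‖w - R i‖

lemma exists_cell (R : ι → H) (w : H) : ∃ i, cell R w i := by
  classical
  obtain ⟨i0, h0⟩ := Finite.exists_min (fun i => ‖w - R i‖)
  have hne : (Finset.univ.filter fun i => ∀ k, ‖w - R i‖ ≤ ‖w - R k‖).Nonempty :=
    ⟨i0, by simpa using h0⟩
  refine ⟨Finset.min' _ hne, ?_, ?_⟩
  · have := Finset.min'_mem _ hne
    exact (Finset.mem_filter.1 this).2
  · intro k hk h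
    have h1 := (Finset.mem_filter.1 (Finset.min'_mem _ hne)).2
    have h2 := Finset.min'_le (Finset.univ.filter fun i => ∀ k, ‖w - R i‖ ≤ ‖w - R k‖) k
      (by simpa using fun l => h.trans (h1 l))
    exact absurd hk (not_lt.2 h2)

lemma cell_unique (R : ι → H) (w : H) (i j : ι) (hi : cell R w i) (hj : cell R w j) : i = j := by
  rcases lt_trichotomy i j with h | h | h
  · exact absurd (hi.1 j) (hj.2 i h)
  · exact h
  · exact absurd (hj.1 i) (hi.2 j h)

noncomputable def jj (R : ι → H) (w : H) : ι := (exists_cell R w).choose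

lemma jj_cell (R : ι → H) (w : H) : cell R w (jj R w) := (exists_cell R w).choose_spec

lemma jj_le (R : ι → H) (w : H) (k : ι) : ‖w - R (jj R w)‖ ≤ ‖w - R k‖ := (jj_cell R w).1 k

lemma jj_eq_iff (R : ι → H) (w : H) (i : ι) : jj R w = i ↔ cell R w i :=
  ⟨fun h => h ▸ jj_cell R w, fun h => cell_unique R w _ _ (jj_cell R w) h⟩

lemma measurableSet_jj (R : ι → H) (i : ι) : MeasurableSet {w | jj R w = i} := by
  simp only [jj_eq_iff, cell]
  have h : ∀ k l, MeasurableSet {w : H | ‖w - R k‖ ≤ ‖w - R l‖} := fun k l =>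
    measurableSet_le (by fun_prop) (by fun_prop)
  refine MeasurableSet.inter (s₁ := {w | ∀ k, ‖w - R i‖ ≤ ‖w - R k‖})
    (s₂ := {w | ∀ k, k < i → ¬ ‖w - R k‖ ≤ ‖w - R i‖}) ?_ ?_
  · rw [ofPred_forall]; exact MeasurableSet.iInter fun k => h _ _
  · rw [ofPred_forall]; refine MeasurableSet.iInter fun k => ?_
    rw [ofPred_forall]; exact MeasurableSet.iInter fun _ => (h k i).compl

noncomputable def del (R : ι → H) (w : H) : ℝ := ‖w - R (jj R w)‖

lemma del_eq (R : ι → H) (w : H) :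
    del R w = Finset.univ.inf' Finset.univ_nonempty (fun i => ‖w - R i‖) := by
  apply le_antisymm
  · exact Finset.le_inf' _ _ fun k _ => jj_le R w k
  · exact Finset.inf'_le _ (Finset.mem_univ _)

lemma continuous_del (R : ι → H) : Continuous (del R) := by
  have : del R = fun w => Finset.univ.inf' Finset.univ_nonempty (fun i => ‖w - R i‖) :=
    funext (del_eq R)
  rw [this]
  exact Continuous.finset_inf'_apply _ fun i _ => by fun_prop

noncomputable def pot (R : ι → H) (c : ι → ℝ) (c0 : ℝ) (w : H) : ℝ :=
  (∑ k, c k * ‖w - R k‖⁻¹) + c0 * (del R w)⁻¹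

noncomputable def fld (R : ι → H) (c : ι → ℝ) (c0 : ℝ) (w : H) : H :=
  (∑ k, c k • F (w - R k)) + c0 • F (w - R (jj R w))

lemma measurable_fld (R : ι → H) (c : ι → ℝ) (c0 : ℝ) : Measurable (fld R c c0) := by
  classical
  have h1 : ∀ p : H, Measurable fun w => F (w - p) := fun p =>
    measurable_F.comp (measurable_id.sub_const p)
  have h2 : (fun w => F (w - R (jj R w))) = fun w => ∑ i, {w | jj R w = i}.indicator (fun w => F (w - R i)) w := by
    ext1 w
    rw [Finset.sum_eq_single (jj R w)]
    · simp
    · intro b _ hb; simp [hb.symm]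
    · simp
  unfold fld
  refine Measurable.add (Finset.measurable_fun_sum _ fun k _ => (h1 _).fun_const_smul _) (Measurable.fun_const_smul ?_ _)
  rw [h2]
  exact Finset.measurable_fun_sum _ fun i _ => (h1 _).indicator (measurableSet_jj R i)

lemma deriv_inv_norm (x ω p : H) (r : ℝ) (h : x + r • ω ≠ p) :
    HasDerivAt (fun r : ℝ => ‖x + r • ω - p‖⁻¹) (- inner ℝ (F (x + r • ω - p)) ω) r := by
  have hne : x + r • ω - p ≠ 0 := sub_ne_zero.2 h
  have hpos : 0 < ‖x + r • ω - p‖ := norm_pos_iff.2 hne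
  have h1 : HasDerivAt (fun r : ℝ => x + r • ω - p) ω r := by
    have := (((hasDerivAt_id r).smul_const ω).const_add x).sub_const p
    simpa using this
  have h2 := (h1.norm_sq.sqrt (by positivity)).inv (by positivity)
  simp only [Real.sqrt_sq (norm_nonneg _)] at h2
  refine h2.congr_deriv ?_
  unfold F
  rw [inner_smul_left]
  simp
  field_simp

lemma affine_norm (x ω p q : H) (r : ℝ) : ‖x + r • ω - p‖ ^ 2 - ‖x + r • ω - q‖ ^ 2 =
    r * (2 * inner ℝ ω (q - p)) + (‖x - p‖ ^ 2 - ‖x - q‖ ^ 2) := by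
  have e : ∀ p : H, ‖x + r • ω - p‖ ^ 2 = ‖x - p‖ ^ 2 + 2 * (r * inner ℝ ω (x - p)) + ‖r • ω‖ ^ 2 := by
    intro p
    have : x + r • ω - p = (x - p) + r • ω := by abel
    rw [this, norm_add_sq_real, inner_smul_right, real_inner_comm]
  rw [e p, e q]
  have : inner ℝ ω (q - p) = inner ℝ ω (x - p) - inner ℝ ω (x - q) := by
    rw [← inner_sub_right]; congr 1; abel
  rw [this]; ring

lemma finite_bad (x ω p q : H) :
    {r : ℝ | ‖x + r • ω - p‖ = ‖x + r • ω - q‖ ∧ ¬ ∀ s : ℝ, ‖x + s • ω - p‖ = ‖x + s • ω - q‖}.Finite := by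
  apply Set.Subsingleton.finite
  rintro r ⟨hr, hn⟩ s ⟨hs, -⟩
  by_contra hrs
  apply hn
  have e1 := affine_norm x ω p q r
  have e2 := affine_norm x ω p q s
  rw [hr, sub_self] at e1
  rw [hs, sub_self] at e2
  have h3 : (r - s) * (2 * inner ℝ ω (q - p)) = 0 := by linarith
  have h4 := (mul_eq_zero.1 h3).resolve_left (sub_ne_zero.2 hrs)
  intro t
  have e3 := affine_norm x ω p q t
  rw [h4] at e1 e3
  have : ‖x + t • ω - p‖ ^ 2 = ‖x + t • ω - q‖ ^ 2 := by linarith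
  exact (pow_left_inj₀ (norm_nonneg _) (norm_nonneg _) two_ne_zero).1 this

lemma jj_locconst (R : ι → H) (x ω : H) : ∃ S : Set ℝ, S.Countable ∧
    ∀ r ∉ S, ∀ᶠ s in 𝓝 r, jj R (x + s • ω) = jj R (x + r • ω) := by
  refine ⟨⋃ i, ⋃ k, {r : ℝ | ‖x + r • ω - R i‖ = ‖x + r • ω - R k‖ ∧ ¬ ∀ s : ℝ, ‖x + s • ω - R i‖ = ‖x + s • ω - R k‖},
    (Set.countable_iUnion fun i => Set.countable_iUnion fun k => (finite_bad x ω _ _).countable), ?_⟩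
  intro r hr
  simp only [mem_iUnion, not_exists] at hr
  have key : ∀ i k, ∀ᶠ s in 𝓝 r, (‖x + s • ω - R i‖ ≤ ‖x + s • ω - R k‖ ↔ ‖x + r • ω - R i‖ ≤ ‖x + r • ω - R k‖) := by
    intro i k
    have c : ∀ i, Continuous fun s : ℝ => ‖x + s • ω - R i‖ := fun i => by fun_prop
    rcases lt_trichotomy (‖x + r • ω - R i‖) (‖x + r • ω - R k‖) with h | h | h
    · filter_upwards [(c i).continuousAt.eventually_lt (c k).continuousAt h] with s hs
      exact ⟨fun _ => h.le, fun _ => hs.le⟩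
    · have : ∀ s : ℝ, ‖x + s • ω - R i‖ = ‖x + s • ω - R k‖ := by
        by_contra hh
        exact hr i k ⟨h, hh⟩
      exact .of_forall fun s => by simp [this]
    · filter_upwards [(c k).continuousAt.eventually_lt (c i).continuousAt h] with s hs
      exact ⟨fun h' => absurd hs (not_lt.2 h'), fun h' => absurd h (not_lt.2 h')⟩
  have key2 : ∀ᶠ s in 𝓝 r, ∀ i k, (‖x + s • ω - R i‖ ≤ ‖x + s • ω - R k‖ ↔ ‖x + r • ω - R i‖ ≤ ‖x + r • ω - R k‖) :=
    eventually_all.2 fun i => eventually_all.2 fun k => key i k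
  filter_upwards [key2] with s hs
  rw [jj_eq_iff]
  have := jj_cell R (x + r • ω)
  exact ⟨fun k => (hs _ _).2 (this.1 k), fun k hk h => this.2 k hk ((hs _ _).1 h)⟩

lemma tendsto_norm_ray (x ω p : H) (hω : ‖ω‖ = 1) :
    Tendsto (fun r : ℝ => ‖x + r • ω - p‖) atTop atTop := by
  have : Tendsto (fun r : ℝ => r - ‖x - p‖) atTop atTop := tendsto_atTop_add_const_right _ _ tendsto_id
  refine tendsto_atTop_mono (fun r => ?_) this
  have h1 : r ≤ ‖r • ω‖ := by rw [norm_smul, hω, mul_one]; exact le_abs_self r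
  have h2 : ‖r • ω‖ ≤ ‖x + r • ω - p‖ + ‖x - p‖ := by
    have : r • ω = (x + r • ω - p) - (x - p) := by abel
    calc ‖r • ω‖ = ‖(x + r • ω - p) - (x - p)‖ := by rw [← this]
      _ ≤ _ := norm_sub_le _ _
  linarith

lemma ray (R : ι → H) (c : ι → ℝ) (c0 : ℝ) (x ω : H) (hω : ‖ω‖ = 1) (L : ℝ)
    (hav : ∀ k, ∀ r : ℝ, 0 < r → x + r • ω ≠ R k)
    (h0 : Tendsto (fun r : ℝ => pot R c c0 (x + r • ω)) (𝓝[>] 0) (𝓝 L))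
    (hi : IntegrableOn (fun r : ℝ => inner ℝ (fld R c c0 (x + r • ω)) ω) (Ioi 0)) :
    ∫ r in Ioi (0:ℝ), inner ℝ (fld R c c0 (x + r • ω)) ω = L := by
  obtain ⟨S, hS, hloc⟩ := jj_locconst R x ω
  refine ftc (fun r => pot R c c0 (x + r • ω)) _ L S hS ?_ ?_ h0 ?_ hi
  · unfold pot
    refine ContinuousOn.add (continuousOn_finsetSum _ fun k _ => ?_) ?_
    · refine ContinuousOn.mul continuousOn_const (ContinuousOn.inv₀ (by fun_prop) fun r hr => ?_)
      exact norm_ne_zero_iff.2 (sub_ne_zero.2 (hav k r hr))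
    · refine ContinuousOn.mul continuousOn_const (ContinuousOn.inv₀ ?_ fun r hr => ?_)
      · exact ((continuous_del R).comp (by fun_prop)).continuousOn
      · exact norm_ne_zero_iff.2 (sub_ne_zero.2 (hav _ r hr))
  · intro r hr hrS
    have h1 : ∀ k, HasDerivAt (fun r : ℝ => ‖x + r • ω - R k‖⁻¹) (- inner ℝ (F (x + r • ω - R k)) ω) r :=
      fun k => deriv_inv_norm x ω _ r (hav k r hr)
    have h2 : HasDerivAt (fun r : ℝ => (del R (x + r • ω))⁻¹)
        (- inner ℝ (F (x + r • ω - R (jj R (x + r • ω)))) ω) r := by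
      refine (h1 (jj R (x + r • ω))).congr_of_eventuallyEq ?_
      filter_upwards [hloc r hrS] with s hs
      rw [del, hs]
    have h3 := (HasDerivAt.fun_sum (u := Finset.univ) fun k _ => (h1 k).const_mul (c k)).add (h2.const_mul c0)
    refine h3.congr_deriv ?_
    unfold fld
    rw [inner_add_left, sum_inner]
    simp [inner_smul_left]
    ring
  · have t1 : ∀ k, Tendsto (fun r : ℝ => ‖x + r • ω - R k‖⁻¹) atTop (𝓝 0) := fun k =>
      (tendsto_norm_ray x ω (R k) hω).inv_tendsto_atTop
    have t2 : Tendsto (fun r : ℝ => (del R (x + r • ω))⁻¹) atTop (𝓝 0) := by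
      have := tendsto_finsetSum Finset.univ fun k _ => t1 k
      rw [Finset.sum_const_zero] at this
      refine squeeze_zero (fun r => by unfold del; positivity) (fun r => ?_) this
      exact Finset.single_le_sum (f := fun k => ‖x + r • ω - R k‖⁻¹) (fun i _ => by positivity) (Finset.mem_univ (jj R (x + r • ω)))
    have t3 := (tendsto_finsetSum Finset.univ fun k _ => (t1 k).const_mul (c k)).add (t2.const_mul c0)
    simpa [pot] using t3

/-- the Newton formula -/
lemma newton (R : ι → H) (c : ι → ℝ) (c0 : ℝ) (x : H) (L : ℝ)
    (h0 : Tendsto (pot R c c0) (𝓝[≠] x) (𝓝 L))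
    (hi : Integrable (fun w => inner ℝ (fld R c c0 w) (F (w - x)))) :
    ∫ w, inner ℝ (fld R c c0 w) (F (w - x)) = 4 * Real.pi * L := by
  obtain ⟨p1, p2⟩ := polar _ hi x
  rw [p2]
  have hav : ∀ᵐ ω : sphere (0:H) 1 ∂(volume : Measure H).toSphere, ∀ k, ∀ r : ℝ, 0 < r → x + r • (ω : H) ≠ R k :=
    ae_all_iff.2 fun k => sphere_ray x (R k)
  have e : ∀ ω : sphere (0:H) 1, EqOn (fun r : ℝ => r ^ 2 * inner ℝ (fld R c c0 (x + r • (ω:H))) (F (x + r • (ω:H) - x)))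
      (fun r : ℝ => inner ℝ (fld R c c0 (x + r • (ω:H))) (ω:H)) (Ioi 0) := by
    intro ω r hr
    have hr : 0 < r := hr
    have hω : ‖(ω:H)‖ = 1 := by simp
    simp only [F, add_sub_cancel_left, norm_smul, hω, mul_one, Real.norm_of_nonneg hr.le, inner_smul_right]
    field_simp
  have : ∀ᵐ ω : sphere (0:H) 1 ∂(volume : Measure H).toSphere,
      (∫ r in Ioi (0 : ℝ), r ^ 2 * inner ℝ (fld R c c0 (x + r • (ω:H))) (F (x + r • (ω:H) - x))) = L := by
    filter_upwards [p1, hav] with ω h1 h2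
    have hω : ‖(ω:H)‖ = 1 := by simp
    rw [setIntegral_congr_fun measurableSet_Ioi (e ω)]
    refine ray R c c0 x ω hω L h2 ?_ ((integrableOn_congr_fun (e ω) measurableSet_Ioi).1 h1)
    refine h0.comp (tendsto_nhdsWithin_iff.2 ⟨?_, ?_⟩)
    · have : Tendsto (fun r : ℝ => x + r • (ω:H)) (𝓝 0) (𝓝 (x + (0:ℝ) • (ω:H))) :=
        Continuous.tendsto (by fun_prop) 0
      rw [zero_smul, add_zero] at this
      exact this.mono_left nhdsWithin_le_nhds
    · filter_upwards [self_mem_nhdsWithin] with r hr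
      have hr : 0 < r := hr
      have : (ω:H) ≠ 0 := by rw [← norm_ne_zero_iff, hω]; simp
      simp [hr.ne', this]
  rw [integral_congr_ae this, integral_const, sphere_univ, smul_eq_mul]

end vor
end LY


namespace LY
open Set Filter Topology Metric Pointwise

lemma int1d (a : ℝ) (ha : 0 < a) : IntegrableOn (fun r : ℝ => (a ^ 2 + r ^ 2)⁻¹) (Ioi 0) ∧
    ∫ r in Ioi (0:ℝ), (a ^ 2 + r ^ 2)⁻¹ = Real.pi / (2 * a) := by
  have e : (fun r : ℝ => (a ^ 2 + r ^ 2)⁻¹) = fun r => (a ^ 2)⁻¹ * (fun s : ℝ => (1 + s ^ 2)⁻¹) (a⁻¹ * r) := by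
    ext r
    simp only
    rw [← mul_inv]
    congr 1
    field_simp
  rw [e]
  constructor
  · have := (integrableOn_Ioi_comp_mul_left_iff (fun s : ℝ => (1 + s ^ 2)⁻¹) 0 (inv_pos.2 ha)).2
      integrable_inv_one_add_sq.integrableOn
    exact Integrable.const_mul this _
  · rw [integral_const_mul, integral_comp_mul_left_Ioi (fun s : ℝ => (1 + s ^ 2)⁻¹) _ (inv_pos.2 ha), mul_zero, integral_Ioi_inv_one_add_sq]
    simp
    field_simp

noncomputable def bb (a : ℝ) (x w : H) : ℝ := (‖w - x‖ ^ 2)⁻¹ * (a ^ 2 + ‖w - x‖ ^ 2)⁻¹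

lemma bb_nonneg (a : ℝ) (x w : H) : 0 ≤ bb a x w := by unfold bb; positivity

lemma bb_int (a : ℝ) (ha : 0 < a) (x : H) : Integrable (bb a x) ∧ ∫ w, bb a x w = 2 * Real.pi ^ 2 / a := by
  obtain ⟨i1, i2⟩ := int1d a ha
  have e : ∀ r ∈ Ioi (0:ℝ), r ^ (Module.finrank ℝ H - 1) • ((r ^ 2)⁻¹ * (a ^ 2 + r ^ 2)⁻¹) = (a ^ 2 + r ^ 2)⁻¹ := by
    intro r hr
    have hr : 0 < r := hr
    simp
    field_simp
  have j1 := (integrable_fun_norm_addHaar (volume : Measure H) (f := fun r => (r ^ 2)⁻¹ * (a ^ 2 + r ^ 2)⁻¹)).2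
    ((integrableOn_congr_fun e measurableSet_Ioi).2 i1)
  have j2 := integral_fun_norm_addHaar (volume : Measure H) (fun r => (r ^ 2)⁻¹ * (a ^ 2 + r ^ 2)⁻¹)
  rw [setIntegral_congr_fun measurableSet_Ioi e, i2] at j2
  constructor
  · exact j1.comp_sub_right x
  · unfold bb
    rw [integral_sub_right_eq_self (fun w : H => (‖w‖ ^ 2)⁻¹ * (a ^ 2 + ‖w‖ ^ 2)⁻¹) x, j2]
    have := sphere_univ
    rw [Measure.toSphere_real_apply_univ] at this
    rw [← smul_assoc, nsmul_eq_mul, this, smul_eq_mul]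
    field_simp
    ring

lemma bound1 (a : ℝ) (ha : 0 < a) (x y w : H) (hx : w ≠ x) (hy : w ≠ y) :
    (‖w - x‖ ^ 2)⁻¹ * (a ^ 2 + ‖w - y‖ ^ 2)⁻¹ ≤ bb a x w + bb a y w := by
  have px : 0 < ‖w - x‖ := norm_pos_iff.2 (sub_ne_zero.2 hx)
  have py : 0 < ‖w - y‖ := norm_pos_iff.2 (sub_ne_zero.2 hy)
  rcases le_total (‖w - x‖) (‖w - y‖) with h | h
  · have : (‖w - x‖ ^ 2)⁻¹ * (a ^ 2 + ‖w - y‖ ^ 2)⁻¹ ≤ bb a x w := by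
      unfold bb; gcongr
    linarith [bb_nonneg a y w]
  · have : (‖w - x‖ ^ 2)⁻¹ * (a ^ 2 + ‖w - y‖ ^ 2)⁻¹ ≤ bb a y w := by
      unfold bb; gcongr
    linarith [bb_nonneg a x w]

lemma inv_le_two (a t s : ℝ) (hs : a ≤ t) (ha : 0 < a) (h : s ≤ t) (h0 : 0 ≤ s) : (t ^ 2)⁻¹ ≤ 2 * (a ^ 2 + s ^ 2)⁻¹ := by
  have ht : 0 < t := ha.trans_le hs
  rw [← div_eq_mul_inv, inv_eq_one_div, div_le_div_iff₀ (by positivity) (by positivity)]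
  nlinarith

lemma bound2 (a : ℝ) (ha : 0 < a) (x y w : H) (hxy : 2 * a ≤ ‖x - y‖) :
    (‖w - x‖ ^ 2)⁻¹ * (‖w - y‖ ^ 2)⁻¹ ≤ 2 * (bb a x w + bb a y w) := by
  have tri : ‖x - y‖ ≤ ‖w - x‖ + ‖w - y‖ := by
    have := norm_sub_le (w - y) (w - x)
    rw [sub_sub_sub_cancel_left] at this
    linarith
  rcases le_total (‖w - x‖) (‖w - y‖) with h | h
  · have h1 := inv_le_two a (‖w - y‖) (‖w - x‖) (by linarith) ha h (norm_nonneg _)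
    have : (‖w - x‖ ^ 2)⁻¹ * (‖w - y‖ ^ 2)⁻¹ ≤ 2 * bb a x w := by
      unfold bb
      calc _ ≤ (‖w - x‖ ^ 2)⁻¹ * (2 * (a ^ 2 + ‖w - x‖ ^ 2)⁻¹) := by gcongr
        _ = _ := by ring
    linarith [bb_nonneg a y w]
  · have h1 := inv_le_two a (‖w - x‖) (‖w - y‖) (by linarith) ha h (norm_nonneg _)
    have : (‖w - x‖ ^ 2)⁻¹ * (‖w - y‖ ^ 2)⁻¹ ≤ 2 * bb a y w := by
      unfold bb
      calc _ ≤ (2 * (a ^ 2 + ‖w - y‖ ^ 2)⁻¹) * (‖w - y‖ ^ 2)⁻¹ := by gcongr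
        _ = _ := by ring
    linarith [bb_nonneg a x w]

lemma ae_ne (x : H) : ∀ᵐ w : H, w ≠ x := by
  rw [ae_iff]; simp

/-- two-point kernel -/
lemma kernel (x y : H) (hxy : x ≠ y) :
    Integrable (fun w => inner ℝ (F (w - y)) (F (w - x))) ∧
    (∫ w, ‖inner ℝ (F (w - y)) (F (w - x))‖ ≤ 16 * Real.pi ^ 2 / ‖x - y‖) ∧
    ∫ w, inner ℝ (F (w - y)) (F (w - x)) = 4 * Real.pi * ‖x - y‖⁻¹ := by
  have hpos : 0 < ‖x - y‖ := norm_pos_iff.2 (sub_ne_zero.2 hxy)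
  set a := ‖x - y‖ / 2 with ha
  have hap : 0 < a := by positivity
  obtain ⟨ix, ex⟩ := bb_int a hap x
  obtain ⟨iy, ey⟩ := bb_int a hap y
  have hb : ∀ w, ‖inner ℝ (F (w - y)) (F (w - x))‖ ≤ 2 * (bb a x w + bb a y w) := by
    intro w
    refine (norm_inner_le_norm _ _).trans ?_
    rw [norm_F, norm_F, mul_comm]
    exact bound2 a hap x y w (by rw [ha]; linarith)
  have hm : Measurable (fun w : H => inner ℝ (F (w - y)) (F (w - x))) :=
    (measurable_F.comp (measurable_id.sub_const y)).inner (measurable_F.comp (measurable_id.sub_const x))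
  have hI : Integrable (fun w => inner ℝ (F (w - y)) (F (w - x))) :=
    ((ix.add iy).const_mul 2).mono' hm.aestronglyMeasurable (.of_forall hb)
  refine ⟨hI, ?_, ?_⟩
  · refine (integral_mono hI.norm ((ix.add iy).const_mul 2) hb).trans ?_
    rw [integral_const_mul]
    simp only [Pi.add_apply]
    rw [integral_add ix iy, ex, ey, ha]
    apply le_of_eq
    field_simp
    ring
  · have key := newton (ι := Fin 1) (fun _ => y) (fun _ => 1) 0 x (‖x - y‖⁻¹)
    have ef : ∀ w, fld (ι := Fin 1) (fun _ => y) (fun _ => 1) 0 w = F (w - y) := by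
      intro w; simp [fld]
    simp only [ef] at key
    refine key ?_ hI
    have ep : pot (ι := Fin 1) (fun _ => y) (fun _ => 1) 0 = fun w => ‖w - y‖⁻¹ := by
      ext w; simp [pot]
    rw [ep]
    have : ContinuousAt (fun w => ‖w - y‖⁻¹) x := ContinuousAt.inv₀ (by fun_prop) hpos.ne'
    exact this.tendsto.mono_left nhdsWithin_le_nhds

section vor
variable {ι : Type} [Fintype ι] [LinearOrder ι] [Nonempty ι]

lemma sep (R : ι → H) (a : ℝ) (hR : ∀ i k, i ≠ k → 2 * a ≤ ‖R i - R k‖) (w : H) (i : ι)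
    (h : jj R w ≠ i) : a ≤ ‖w - R i‖ := by
  have h1 := hR _ _ h
  have h2 := jj_le R w i
  have := norm_sub_le (w - R i) (w - R (jj R w))
  rw [sub_sub_sub_cancel_left] at this
  linarith

lemma sepF (R : ι → H) (a : ℝ) (ha : 0 < a) (hR : ∀ i k, i ≠ k → 2 * a ≤ ‖R i - R k‖) (w : H) (i : ι)
    (h : jj R w ≠ i) : ‖F (w - R i)‖ ≤ 2 * (a ^ 2 + ‖w - R i‖ ^ 2)⁻¹ := by
  rw [norm_F]
  exact inv_le_two a _ _ (sep R a hR w i h) ha le_rfl (norm_nonneg _)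

noncomputable def ee (R : ι → H) : H → H := fld R (fun _ => 1) (-1)

lemma ee_eq (R : ι → H) (w : H) : ee R w = ∑ i ∈ Finset.univ.erase (jj R w), F (w - R i) := by
  unfold ee fld
  rw [← Finset.add_sum_erase _ _ (Finset.mem_univ (jj R w))]
  simp only [one_smul, neg_smul]
  abel

lemma cross (R : ι → H) (a : ℝ) (ha : 0 < a) (hR : ∀ i k, i ≠ k → 2 * a ≤ ‖R i - R k‖) :
    ∃ C : ℝ, ∀ x, Integrable (fun w => inner ℝ (ee R w) (F (w - x))) ∧
      ∫ w, ‖inner ℝ (ee R w) (F (w - x))‖ ≤ C := by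
  refine ⟨∑ i : ι, 2 * (2 * Real.pi ^ 2 / a + 2 * Real.pi ^ 2 / a), fun x => ?_⟩
  have hb : ∀ᵐ w : H, ‖inner ℝ (ee R w) (F (w - x))‖ ≤ ∑ i, 2 * (bb a x w + bb a (R i) w) := by
    filter_upwards [ae_ne x, ae_all_iff.2 fun i => ae_ne (R i)] with w h1 h2
    calc _ ≤ ‖ee R w‖ * ‖F (w - x)‖ := norm_inner_le_norm _ _
      _ ≤ (∑ i, 2 * (a ^ 2 + ‖w - R i‖ ^ 2)⁻¹) * ‖F (w - x)‖ := by
        gcongr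
        rw [ee_eq]
        refine (norm_sum_le_of_le _ (f := fun i => F (w - R i)) (n := fun i => 2 * (a ^ 2 + ‖w - R i‖ ^ 2)⁻¹) ?_).trans ?_
        · intro i hi
          exact sepF R a ha hR w i (Finset.ne_of_mem_erase hi).symm
        · exact Finset.sum_le_sum_of_subset_of_nonneg (Finset.subset_univ _) fun _ _ _ => by positivity
      _ = ∑ i, 2 * ((‖w - x‖ ^ 2)⁻¹ * (a ^ 2 + ‖w - R i‖ ^ 2)⁻¹) := by
        rw [norm_F, Finset.sum_mul]
        exact Finset.sum_congr rfl fun _ _ => by ring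
      _ ≤ _ := by
        refine Finset.sum_le_sum fun i _ => ?_
        have := bound1 a ha x (R i) w h1 (h2 i)
        linarith
  have hBi : ∀ i, Integrable (fun w => 2 * (bb a x w + bb a (R i) w)) := fun i =>
    ((bb_int a ha x).1.add (bb_int a ha (R i)).1).const_mul 2
  have hB : Integrable (fun w => ∑ i, 2 * (bb a x w + bb a (R i) w)) :=
    integrable_finsetSum _ fun i _ => hBi i
  have hI : Integrable (fun w => inner ℝ (ee R w) (F (w - x))) :=
    hB.mono' ((measurable_fld _ _ _).inner (measurable_F.comp (measurable_id.sub_const x))).aestronglyMeasurable hb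
  refine ⟨hI, (integral_mono_ae hI.norm hB hb).trans (le_of_eq ?_)⟩
  rw [integral_finsetSum _ fun i _ => hBi i]
  refine Finset.sum_congr rfl fun i _ => ?_
  rw [integral_const_mul, integral_add (bb_int a ha x).1 (bb_int a ha (R i)).1, (bb_int a ha x).2, (bb_int a ha (R i)).2]

lemma jj_near (R : ι → H) (a : ℝ) (ha : 0 < a) (hR : ∀ i k, i ≠ k → 2 * a ≤ ‖R i - R k‖) (i : ι) :
    ∀ᶠ w in 𝓝 (R i), jj R w = i := by
  filter_upwards [Metric.ball_mem_nhds (R i) ha] with w hw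
  by_contra h
  have := sep R a hR w i h
  rw [mem_ball, dist_eq_norm] at hw
  linarith

noncomputable def phi (R : ι → H) (x : H) : ℝ := (∑ k, ‖x - R k‖⁻¹) - (del R x)⁻¹

lemma phi_eq (R : ι → H) (w : H) : phi R w = ∑ i ∈ Finset.univ.erase (jj R w), ‖w - R i‖⁻¹ := by
  unfold phi del
  rw [← Finset.add_sum_erase _ _ (Finset.mem_univ (jj R w))]
  ring

lemma newton_phi (R : ι → H) (a : ℝ) (ha : 0 < a) (hR : ∀ i k, i ≠ k → 2 * a ≤ ‖R i - R k‖) (x : H) :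
    ∫ w, inner ℝ (ee R w) (F (w - x)) = 4 * Real.pi * phi R x := by
  obtain ⟨C, hC⟩ := cross R a ha hR
  refine newton R _ _ x _ ?_ (hC x).1
  have ep : pot R (fun _ => 1) (-1) = phi R := by
    ext w; simp [pot, phi]; ring
  rw [ep]
  suffices ContinuousAt (phi R) x from this.tendsto.mono_left nhdsWithin_le_nhds
  by_cases hx : ∃ i, x = R i
  · obtain ⟨i, rfl⟩ := hx
    have : ContinuousAt (fun w => ∑ k ∈ Finset.univ.erase i, ‖w - R k‖⁻¹) (R i) := by
      refine tendsto_finsetSum _ fun k hk => ?_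
      have hk : k ≠ i := Finset.ne_of_mem_erase hk
      refine ContinuousAt.inv₀ (by fun_prop) ?_
      have := hR i k hk.symm
      intro h; linarith
    refine this.congr ?_
    filter_upwards [jj_near R a ha hR i] with w hw
    rw [phi_eq, hw]
  · push Not at hx
    unfold phi
    refine ContinuousAt.sub (tendsto_finsetSum _ fun k hk => ?_) (ContinuousAt.inv₀ (continuous_del R).continuousAt ?_)
    · exact ContinuousAt.inv₀ (by fun_prop) (norm_ne_zero_iff.2 (sub_ne_zero.2 (hx k)))
    · exact (norm_ne_zero_iff.2 (sub_ne_zero.2 (hx _)))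

lemma offcell (R : ι → H) (a : ℝ) (ha : 0 < a) (hR : ∀ i k, i ≠ k → 2 * a ≤ ‖R i - R k‖) (i : ι) :
    IntegrableOn (fun w => inner ℝ (F (w - R (jj R w))) (F (w - R i))) {w | jj R w ≠ i} ∧
    IntegrableOn (fun w => inner ℝ (F (w - R i)) (F (w - R i))) {w | jj R w ≠ i} ∧
    ∫ w in {w | jj R w ≠ i}, inner ℝ (F (w - R (jj R w))) (F (w - R i)) =
    ∫ w in {w | jj R w ≠ i}, inner ℝ (F (w - R i)) (F (w - R i)) := by
  have hms : MeasurableSet {w | jj R w ≠ i} := (measurableSet_jj R i).compl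
  have hB : Integrable (fun w => ∑ k, 2 * (bb a (R k) w + bb a (R i) w)) :=
    integrable_finsetSum _ fun k _ => ((bb_int a ha (R k)).1.add (bb_int a ha (R i)).1).const_mul 2
  have mi : Measurable fun w : H => F (w - R i) := measurable_F.comp (measurable_id.sub_const _)
  have mj : Measurable fun w : H => F (w - R (jj R w)) := by
    have := measurable_fld R 0 1
    unfold fld at this
    simpa using this
  have bd : ∀ᵐ w : H, jj R w ≠ i → ∀ k, ‖inner ℝ (F (w - R k)) (F (w - R i))‖ ≤ ∑ k, 2 * (bb a (R k) w + bb a (R i) w) := by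
    filter_upwards [ae_all_iff.2 fun i => ae_ne (R i)] with w h2 hw k
    calc _ ≤ ‖F (w - R k)‖ * ‖F (w - R i)‖ := norm_inner_le_norm _ _
      _ ≤ (‖w - R k‖ ^ 2)⁻¹ * (2 * (a ^ 2 + ‖w - R i‖ ^ 2)⁻¹) := by
        gcongr
        · rw [norm_F]
        · exact sepF R a ha hR w i hw
      _ ≤ 2 * (bb a (R k) w + bb a (R i) w) := by
        have := bound1 a ha (R k) (R i) w (h2 k) (h2 i)
        linarith
      _ ≤ _ := Finset.single_le_sum (f := fun k => 2 * (bb a (R k) w + bb a (R i) w))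
        (fun k _ => by have := bb_nonneg a (R k) w; have := bb_nonneg a (R i) w; positivity) (Finset.mem_univ k)
  have I1 : IntegrableOn (fun w => inner ℝ (F (w - R (jj R w))) (F (w - R i))) {w | jj R w ≠ i} := by
    refine Integrable.mono' hB.integrableOn (mj.inner mi).aestronglyMeasurable ?_
    rw [ae_restrict_iff' hms]
    filter_upwards [bd] with w h hw using h hw _
  have I2 : IntegrableOn (fun w => inner ℝ (F (w - R i)) (F (w - R i))) {w | jj R w ≠ i} := by
    refine Integrable.mono' hB.integrableOn (mi.inner mi).aestronglyMeasurable ?_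
    rw [ae_restrict_iff' hms]
    filter_upwards [bd] with w h hw using h hw _
  refine ⟨I1, I2, ?_⟩
  have ef : ∀ w, inner ℝ (fld R (fun k => if k = i then -1 else 0) 1 w) (F (w - R i)) =
      {w | jj R w ≠ i}.indicator (fun w => inner ℝ (F (w - R (jj R w))) (F (w - R i)) - inner ℝ (F (w - R i)) (F (w - R i))) w := by
    intro w
    have : fld R (fun k => if k = i then -1 else 0) 1 w = F (w - R (jj R w)) - F (w - R i) := by
      simp [fld]; abel
    rw [this]
    by_cases h : jj R w = i
    · simp [h]
    · simp [h, inner_sub_left]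
  have key := newton R (fun k => if k = i then -1 else 0) 1 (R i) 0 ?_ ?_
  · simp only [ef] at key
    rw [integral_indicator hms, integral_sub I1 I2, mul_zero] at key
    linarith
  · refine Tendsto.mono_left ?_ nhdsWithin_le_nhds
    refine tendsto_const_nhds.congr' ?_
    filter_upwards [jj_near R a ha hR i] with w hw
    simp [pot, del, hw]
  · simp only [ef]
    rw [integrable_indicator_iff hms]
    exact I1.sub I2

end vor

lemma half (p q : H) (hpq : p ≠ q) :
    ∫ w in {w | ‖w - q‖ < ‖w - p‖}, inner ℝ (F (w - p)) (F (w - p)) = 2 * Real.pi * ‖p - q‖⁻¹ := by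
  have hpos : 0 < ‖p - q‖ := norm_pos_iff.2 (sub_ne_zero.2 hpq)
  have h := offcell (ι := Fin 2) ![p, q] (‖p - q‖ / 2) (by positivity) ?_ 0
  · have hset : {w | jj ![p, q] w ≠ 0} = {w | ‖w - q‖ < ‖w - p‖} := by
      ext w
      show ¬ (jj ![p, q] w = 0) ↔ ‖w - q‖ < ‖w - p‖
      rw [jj_eq_iff, cell]
      simp
    have h1 : ∀ w, w ∈ {w | ‖w - q‖ < ‖w - p‖} → jj ![p, q] w = 1 := by
      intro w hw
      rw [← hset] at hw
      have : jj ![p, q] w ≠ 0 := hw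
      exact Fin.eq_one_of_ne_zero _ this
    obtain ⟨-, -, h3⟩ := h
    rw [hset] at h3
    simp only [Matrix.cons_val_zero] at h3
    rw [← h3]
    have hm1 : MeasurableSet {w : H | ‖w - q‖ < ‖w - p‖} := measurableSet_lt (by fun_prop) (by fun_prop)
    have hm2 : MeasurableSet {w : H | ‖w - p‖ < ‖w - q‖} := measurableSet_lt (by fun_prop) (by fun_prop)
    rw [setIntegral_congr_fun (g := fun w => inner ℝ (F (w - q)) (F (w - p))) hm1 fun w hw => by
      simp [h1 w hw]]
    obtain ⟨k1, -, k3⟩ := kernel p q hpq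
    -- symmetric
    have hsym : ∫ w in {w | ‖w - q‖ < ‖w - p‖}, inner ℝ (F (w - q)) (F (w - p)) =
        ∫ w in {w | ‖w - p‖ < ‖w - q‖}, inner ℝ (F (w - q)) (F (w - p)) := by
      rw [← integral_indicator hm1, ← integral_indicator hm2, ← integral_sub_left_eq_self _ volume (p + q)]
      congr 1
      ext w
      have e1 : p + q - w - q = -(w - p) := by abel
      have e2 : p + q - w - p = -(w - q) := by abel
      simp only [indicator, mem_ofPred_eq, e1, e2, norm_neg, F_neg, inner_neg_neg]
      rw [real_inner_comm]
    have hnull : volume {w : H | ‖w - p‖ = ‖w - q‖} = 0 := by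
      have : {w : H | ‖w - p‖ = ‖w - q‖} = (AffineSubspace.perpBisector p q : Set H) := by
        ext w
        simp [AffineSubspace.mem_perpBisector_iff_dist_eq, dist_eq_norm]
      rw [this]
      apply Measure.addHaar_affineSubspace
      simpa using hpq
    have hcompl : ({w : H | ‖w - q‖ < ‖w - p‖}ᶜ : Set H) =ᵐ[volume] {w : H | ‖w - p‖ < ‖w - q‖} := by
      have : ∀ᵐ w : H, ‖w - p‖ ≠ ‖w - q‖ := by
        rw [ae_iff]; simpa using hnull
      filter_upwards [this] with w hw
      apply propext
      show ¬ (‖w - q‖ < ‖w - p‖) ↔ ‖w - p‖ < ‖w - q‖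
      rw [not_lt]
      exact ⟨fun h => lt_of_le_of_ne h hw, le_of_lt⟩
    have hs := integral_add_compl hm1 k1
    rw [setIntegral_congr_set hcompl, ← hsym, k3] at hs
    linarith
  · intro i k hik
    fin_cases i <;> fin_cases k <;> simp at hik ⊢
    · linarith
    · rw [norm_sub_rev q p]; linarith

end LY


namespace LY
open Set Filter Topology Metric Pointwise

abbrev E2 := EuclideanSpace ℝ (Fin 2)

section vor
variable {ι : Type} [Fintype ι] [LinearOrder ι] [Nonempty ι]

lemma energy (R : ι → H) (a : ℝ) (ha : 0 < a) (hR : ∀ i k, i ≠ k → 2 * a ≤ ‖R i - R k‖) :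
    Integrable (fun w => ‖ee R w‖ ^ 2) ∧
    ∫ w, ‖ee R w‖ ^ 2 = ∑ i, (4 * Real.pi * phi R (R i)) -
      ∑ i, ∫ w in {w | jj R w ≠ i}, inner ℝ (F (w - R i)) (F (w - R i)) := by
  obtain ⟨C, hC⟩ := cross R a ha hR
  have hms : ∀ i, MeasurableSet {w | jj R w ≠ i} := fun i => (measurableSet_jj R i).compl
  have e : (fun w => ‖ee R w‖ ^ 2) = fun w => ∑ i, inner ℝ (ee R w) (F (w - R i)) -
      ∑ i, {w | jj R w ≠ i}.indicator (fun w => inner ℝ (F (w - R (jj R w))) (F (w - R i))) w := by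
    ext w
    have h1 : inner ℝ (ee R w) (F (w - R (jj R w))) =
        ∑ i, {w | jj R w ≠ i}.indicator (fun w => inner ℝ (F (w - R (jj R w))) (F (w - R i))) w := by
      rw [← Finset.add_sum_erase _ _ (Finset.mem_univ (jj R w))]
      rw [indicator_of_notMem (by simp), zero_add, ee_eq, sum_inner]
      refine Finset.sum_congr rfl fun i hi => ?_
      rw [indicator_of_mem (show w ∈ {w | jj R w ≠ i} from (Finset.ne_of_mem_erase hi).symm), real_inner_comm]
    rw [← h1, ← inner_sum, ← inner_sub_right, ← real_inner_self_eq_norm_sq]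
    congr 1
    simp [ee, fld, sub_eq_add_neg]
  have J1 : ∀ i, Integrable (fun w => inner ℝ (ee R w) (F (w - R i))) := fun i => (hC _).1
  have J2 : ∀ i, Integrable ({w | jj R w ≠ i}.indicator (fun w => inner ℝ (F (w - R (jj R w))) (F (w - R i)))) :=
    fun i => (integrable_indicator_iff (hms i)).2 (offcell R a ha hR i).1
  rw [e]
  refine ⟨(integrable_finsetSum _ fun i _ => J1 i).sub (integrable_finsetSum _ fun i _ => J2 i), ?_⟩
  rw [integral_sub (integrable_finsetSum _ fun i _ => J1 i) (integrable_finsetSum _ fun i _ => J2 i),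
    integral_finsetSum _ fun i _ => J1 i, integral_finsetSum _ fun i _ => J2 i]
  congr 1
  · exact Finset.sum_congr rfl fun i _ => newton_phi R a ha hR _
  · refine Finset.sum_congr rfl fun i _ => ?_
    rw [integral_indicator (hms i), (offcell R a ha hR i).2.2]

lemma offcell_ge (R : ι → H) (a : ℝ) (ha : 0 < a) (hR : ∀ i k, i ≠ k → 2 * a ≤ ‖R i - R k‖) (i k : ι) (hik : i ≠ k) :
    2 * Real.pi * ‖R i - R k‖⁻¹ ≤ ∫ w in {w | jj R w ≠ i}, inner ℝ (F (w - R i)) (F (w - R i)) := by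
  have hne : R i ≠ R k := by
    intro h
    have := hR i k hik
    rw [h, sub_self, norm_zero] at this
    linarith
  rw [← half (R i) (R k) hne]
  refine setIntegral_mono_set (offcell R a ha hR i).2.1 (.of_forall fun w => real_inner_self_nonneg) ?_
  refine LE.le.eventuallyLE fun w hw => ?_
  intro h
  have := jj_le R w k
  rw [h] at this
  exact absurd hw (not_lt.2 this)

lemma ae_range (T : E2 →ₗᵢ[ℝ] H) : ∀ᵐ w : H, ∃ d > 0, ∀ x, d ≤ ‖w - T x‖ := by
  have h1 : volume ((LinearMap.range T.toLinearMap : Submodule ℝ H) : Set H) = 0 := by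
    apply Measure.addHaar_submodule
    intro h
    have h2 := LinearMap.finrank_range_le T.toLinearMap
    rw [h, finrank_top] at h2
    simp at h2
  have h2 : ∀ᵐ w : H, w ∉ ((LinearMap.range T.toLinearMap : Submodule ℝ H) : Set H) := measure_eq_zero_iff_ae_notMem.1 h1
  have hcl : IsClosed ((LinearMap.range T.toLinearMap : Submodule ℝ H) : Set H) := Submodule.closed_of_finiteDimensional _
  filter_upwards [h2] with w hw
  refine ⟨_, (hcl.notMem_iff_infDist_pos ⟨0, Submodule.zero_mem _⟩).1 hw, fun x => ?_⟩
  rw [← dist_eq_norm]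
  exact infDist_le_dist_of_mem ⟨x, rfl⟩

lemma ae_diag : ∀ᵐ p : E2 × E2, p.1 ≠ p.2 := by
  have hm : MeasurableSet {p : E2 × E2 | p.1 = p.2} := measurableSet_eq_fun measurable_fst measurable_snd
  rw [ae_iff]
  simp only [ne_eq, not_not]
  rw [Measure.volume_eq_prod, Measure.measure_prod_null hm]
  refine .of_forall fun x => ?_
  have : Prod.mk x ⁻¹' {p : E2 × E2 | p.1 = p.2} = {x} := by
    ext y; simp [eq_comm]
  show volume (Prod.mk x ⁻¹' {p : E2 × E2 | p.1 = p.2}) = 0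
  rw [this]; simp

lemma core (T : E2 →ₗᵢ[ℝ] H) (R : ι → H) (a : ℝ) (ha : 0 < a) (hR : ∀ i k, i ≠ k → 2 * a ≤ ‖R i - R k‖)
    (z : ℝ) (ρ : E2 → ℝ) (hρ : Integrable ρ)
    (hD : Integrable (fun p : E2 × E2 => ρ p.1 * ρ p.2 / ‖p.1 - p.2‖)) :
    0 ≤ 4 * Real.pi * (∫ p : E2 × E2, ρ p.1 * ρ p.2 / ‖p.1 - p.2‖)
      - 2 * z * (4 * Real.pi * ∫ x, phi R (T x) * ρ x) + z ^ 2 * ∫ w, ‖ee R w‖ ^ 2 := by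
  obtain ⟨C, hC⟩ := cross R a ha hR
  have hTm : Measurable T := T.continuous.measurable
  set G1 : H × (E2 × E2) → ℝ := fun q => ρ q.2.1 * ρ q.2.2 * inner ℝ (F (q.1 - T q.2.2)) (F (q.1 - T q.2.1)) with hG1
  set G2 : H × E2 → ℝ := fun q => ρ q.2 * inner ℝ (ee R q.1) (F (q.1 - T q.2)) with hG2
  have hTn : ∀ x y, ‖T x - T y‖ = ‖x - y‖ := fun x y => by rw [← map_sub, T.norm_map]
  have m1 : AEStronglyMeasurable G1 (volume.prod volume) := by
    have r1 : AEStronglyMeasurable (fun p : E2 × E2 => ρ p.1 * ρ p.2) volume :=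
      hρ.1.comp_fst.mul hρ.1.comp_snd
    refine AEStronglyMeasurable.mul (r1.comp_snd (μ := (volume : Measure H))) ?_
    apply Measurable.aestronglyMeasurable
    apply Measurable.inner
    · exact measurable_F.comp (measurable_fst.sub (hTm.comp (measurable_snd.comp measurable_snd)))
    · exact measurable_F.comp (measurable_fst.sub (hTm.comp (measurable_fst.comp measurable_snd)))
  have m2 : AEStronglyMeasurable G2 (volume.prod volume) := by
    refine AEStronglyMeasurable.mul (hρ.1.comp_snd (μ := (volume : Measure H))) ?_
    apply Measurable.aestronglyMeasurable
    apply Measurable.inner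
    · exact (measurable_fld _ _ _).comp measurable_fst
    · exact measurable_F.comp (measurable_fst.sub (hTm.comp measurable_snd))
  have I1 : Integrable G1 (volume.prod volume) := by
    rw [integrable_prod_iff' m1]
    constructor
    · filter_upwards [ae_diag] with p hp
      exact (kernel (T p.1) (T p.2) (T.injective.ne hp)).1.const_mul (ρ p.1 * ρ p.2)
    · refine Integrable.mono' (hD.norm.const_mul (16 * Real.pi ^ 2)) m1.norm.prod_swap.integral_prod_right' ?_
      filter_upwards [ae_diag] with p hp
      have := (kernel (T p.1) (T p.2) (T.injective.ne hp)).2.1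
      rw [hTn] at this
      rw [Real.norm_of_nonneg (integral_nonneg fun _ => norm_nonneg _)]
      simp only [hG1, norm_mul]
      rw [integral_const_mul]
      calc _ ≤ ‖ρ p.1‖ * ‖ρ p.2‖ * (16 * Real.pi ^ 2 / ‖p.1 - p.2‖) := by gcongr
        _ = _ := by rw [norm_div, norm_mul, norm_norm]; ring
  have I2 : Integrable G2 (volume.prod volume) := by
    rw [integrable_prod_iff' m2]
    constructor
    · exact .of_forall fun x => (hC (T x)).1.const_mul (ρ x)
    · refine Integrable.mono' (hρ.norm.const_mul C) m2.norm.prod_swap.integral_prod_right' ?_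
      refine .of_forall fun x => ?_
      rw [Real.norm_of_nonneg (integral_nonneg fun _ => norm_nonneg _)]
      simp only [hG2, norm_mul]
      rw [integral_const_mul, mul_comm]
      gcongr
      simpa using (hC (T x)).2
  have V1 : ∫ q, G1 q ∂(volume.prod volume) = 4 * Real.pi * (∫ p : E2 × E2, ρ p.1 * ρ p.2 / ‖p.1 - p.2‖) := by
    rw [integral_prod_symm _ I1, ← integral_const_mul]
    refine integral_congr_ae ?_
    filter_upwards [ae_diag] with p hp
    simp only [hG1]
    rw [integral_const_mul, (kernel (T p.1) (T p.2) (T.injective.ne hp)).2.2, hTn]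
    ring
  have V2 : ∫ q, G2 q ∂(volume.prod volume) = 4 * Real.pi * ∫ x, phi R (T x) * ρ x := by
    rw [integral_prod_symm _ I2, ← integral_const_mul]
    refine integral_congr_ae (.of_forall fun x => ?_)
    simp only [hG2]
    rw [integral_const_mul, newton_phi R a ha hR]
    ring
  obtain ⟨I3, -⟩ := energy R a ha hR
  have hpt : ∀ᵐ w : H, 0 ≤ (∫ p, G1 (w, p)) - 2 * z * (∫ x, G2 (w, x)) + z ^ 2 * ‖ee R w‖ ^ 2 := by
    filter_upwards [ae_range T, I1.prod_right_ae] with w hw i1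
    obtain ⟨d, hd, hdx⟩ := hw
    have hint : Integrable (fun x => ρ x • F (w - T x)) := by
      refine Integrable.mono' (hρ.norm.const_mul ((d ^ 2)⁻¹)) ?_ ?_
      · exact hρ.1.smul (measurable_F.comp (hTm.const_sub w)).aestronglyMeasurable
      · refine .of_forall fun x => ?_
        rw [norm_smul, norm_F, mul_comm]
        have := hdx x
        gcongr
    set E : H := ∫ x, ρ x • F (w - T x) with hE
    have e1 : ∫ p, G1 (w, p) = ‖E‖ ^ 2 := by
      rw [Measure.volume_eq_prod, integral_prod _ i1, ← real_inner_self_eq_norm_sq]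
      have hEE : inner ℝ E E = ∫ x, inner ℝ E (ρ x • F (w - T x)) := (integral_inner hint E).symm
      rw [hEE]
      refine integral_congr_ae (.of_forall fun x => ?_)
      simp only
      rw [real_inner_comm]
      have hx : inner ℝ (ρ x • F (w - T x)) E = ∫ y, inner ℝ (ρ x • F (w - T x)) (ρ y • F (w - T y)) :=
        (integral_inner hint _).symm
      rw [hx]
      refine integral_congr_ae (.of_forall fun y => ?_)
      simp only [hG1, real_inner_smul_left, real_inner_smul_right]
      rw [real_inner_comm]
      ring
    have e2 : ∫ x, G2 (w, x) = inner ℝ (ee R w) E := by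
      rw [hE, ← integral_inner hint]
      refine integral_congr_ae (.of_forall fun x => ?_)
      simp only [hG2, inner_smul_right]
    rw [e1, e2]
    have h := norm_sub_sq_real E (z • ee R w)
    rw [inner_smul_right, norm_smul, mul_pow, Real.norm_eq_abs, sq_abs, real_inner_comm] at h
    have h2 := sq_nonneg ‖E - z • ee R w‖
    linarith
  have hfin := integral_nonneg_of_ae hpt
  have J1 := I1.integral_prod_left
  have J2 := I2.integral_prod_left
  have hs : Integrable (fun w => (∫ p, G1 (w, p)) - 2 * z * (∫ x, G2 (w, x))) := J1.sub (J2.const_mul _)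
  rw [integral_add hs (I3.const_mul _), integral_sub J1 (J2.const_mul _), integral_const_mul,
    integral_const_mul, ← integral_prod _ I1, ← integral_prod _ I2, V1, V2] at hfin
  exact hfin

end vor
end LY


namespace LY
open Set Filter Topology Metric Pointwise

noncomputable def TT : E2 →ₗᵢ[ℝ] H where
  toFun x := !₂[x 0, x 1, 0]
  map_add' x y := by ext i; fin_cases i <;> simp
  map_smul' c x := by ext i; fin_cases i <;> simp
  norm_map' x := by
    show ‖(!₂[x 0, x 1, 0] : H)‖ = ‖x‖
    simp [EuclideanSpace.norm_eq, Fin.sum_univ_three]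

lemma TT_sub (x y : E2) : ‖TT x - TT y‖ = ‖x - y‖ := by rw [← map_sub, TT.norm_map]

lemma exists_sep {K : ℕ} (R : Fin K → E2) (hR : Function.Injective R) :
    ∃ a : ℝ, 0 < a ∧ ∀ i k, i ≠ k → 2 * a ≤ ‖TT (R i) - TT (R k)‖ := by
  by_cases hne : Nonempty {p : Fin K × Fin K // p.1 ≠ p.2}
  · obtain ⟨p, hp⟩ := Finite.exists_min (fun p : {p : Fin K × Fin K // p.1 ≠ p.2} => ‖R p.1.1 - R p.1.2‖)
    refine ⟨‖R p.1.1 - R p.1.2‖ / 2, half_pos (norm_pos_iff.2 (sub_ne_zero.2 (hR.ne p.2))), fun i k hik => ?_⟩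
    rw [TT_sub]
    have := hp ⟨(i, k), hik⟩
    simp only at this
    linarith
  · exact ⟨1, one_pos, fun i k hik => (hne ⟨⟨(i, k), hik⟩⟩).elim⟩

lemma iInf_del {K : ℕ} [Nonempty (Fin K)] (R : Fin K → E2) (x : E2) :
    ⨅ i : Fin K, ‖x - R i‖ = del (fun i => TT (R i)) (TT x) := by
  rw [del_eq, Finset.inf'_univ_eq_ciInf]
  simp only [TT_sub]

lemma Phi_eq {K : ℕ} [Nonempty (Fin K)] (z : ℝ) (R : Fin K → E2) (x : E2) :
    ((∑ i : Fin K, z / ‖x - R i‖) - z / ⨅ i : Fin K, ‖x - R i‖) = z * phi (fun i => TT (R i)) (TT x) := by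
  rw [iInf_del, phi, mul_sub, Finset.mul_sum]
  simp only [TT_sub, div_eq_mul_inv]

lemma U_eq {K : ℕ} [Nonempty (Fin K)] (z : ℝ) (R : Fin K → E2) (hR : Function.Injective R) :
    ∑ i : Fin K, ∑ j ∈ Finset.Ioi i, z ^ 2 / ‖R i - R j‖ =
      z ^ 2 / 2 * ∑ i, phi (fun i => TT (R i)) (TT (R i)) := by
  have h1 : ∀ i, phi (fun i => TT (R i)) (TT (R i)) = ∑ k ∈ {i}ᶜ, ‖R k - R i‖⁻¹ := by
    intro i
    have hj : jj (fun i => TT (R i)) (TT (R i)) = i := by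
      have := jj_le (fun i => TT (R i)) (TT (R i)) i
      simp only [TT_sub, sub_self, norm_zero] at this
      have h0 := sub_eq_zero.1 (norm_le_zero_iff.1 this)
      exact (hR h0).symm
    rw [phi_eq, hj, ← Finset.compl_singleton]
    refine Finset.sum_congr rfl fun k _ => ?_
    rw [TT_sub, norm_sub_rev]
  have h2 := Finset.sum_sum_Ioi_add_eq_sum_sum_off_diag (fun i j : Fin K => ‖R i - R j‖⁻¹)
  simp only [h1]
  rw [← h2, Finset.mul_sum]
  refine Finset.sum_congr rfl fun i _ => ?_
  rw [Finset.mul_sum]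
  refine Finset.sum_congr rfl fun j _ => ?_
  rw [norm_sub_rev (R j)]
  ring

lemma int_case {K : ℕ} (hK : 2 ≤ K) (z : ℝ)
    (R : Fin K → E2) (hR : Function.Injective R)
    (ρ : E2 → ℝ) (hρ : Integrable ρ)
    (hD : Integrable (fun p : E2 × E2 => ρ p.1 * ρ p.2 / ‖p.1 - p.2‖)) :
    z ^ 2 / 8 * ∑ j : Fin K, 1 / ((1 / 2) * ⨅ k : {k : Fin K // k ≠ j}, ‖R k - R j‖) ≤
    (1 / 2) * (∫ p : E2 × E2, ρ p.1 * ρ p.2 / ‖p.1 - p.2‖)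
      - (∫ x, ((∑ i : Fin K, z / ‖x - R i‖) - z / ⨅ i : Fin K, ‖x - R i‖) * ρ x)
      + ∑ i : Fin K, ∑ j ∈ Finset.Ioi i, z ^ 2 / ‖R i - R j‖ := by
  haveI : Nonempty (Fin K) := ⟨⟨0, by omega⟩⟩
  haveI : Nontrivial (Fin K) := Fin.nontrivial_iff_two_le.2 hK
  obtain ⟨a, ha, hsep⟩ := exists_sep R hR
  have hc := core TT (fun i => TT (R i)) a ha hsep z ρ hρ hD
  rw [(energy (fun i => TT (R i)) a ha hsep).2, ← Finset.mul_sum] at hc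
  rw [U_eq z R hR]
  simp only [Phi_eq, mul_assoc]
  rw [integral_const_mul]
  have hI : Real.pi * ∑ j : Fin K, 1 / ((1 / 2) * ⨅ k : {k : Fin K // k ≠ j}, ‖R k - R j‖) ≤
      ∑ i, ∫ w in {w | jj (fun i => TT (R i)) w ≠ i}, inner ℝ (F (w - TT (R i))) (F (w - TT (R i))) := by
    rw [Finset.mul_sum]
    refine Finset.sum_le_sum fun j _ => ?_
    haveI : Nonempty {k : Fin K // k ≠ j} := let ⟨k, hk⟩ := exists_ne j; ⟨⟨k, hk⟩⟩
    obtain ⟨k, hk⟩ := exists_eq_ciInf_of_finite (f := fun k : {k : Fin K // k ≠ j} => ‖R k - R j‖)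
    rw [← hk]
    refine le_trans (le_of_eq ?_) (offcell_ge (fun i => TT (R i)) a ha hsep j k k.2.symm)
    rw [TT_sub, norm_sub_rev]
    field_simp
  have hp := Real.pi_pos
  set S := ∑ j : Fin K, 1 / ((1 / 2) * ⨅ k : {k : Fin K // k ≠ j}, ‖R k - R j‖)
  set I := ∑ i, ∫ w in {w | jj (fun i => TT (R i)) w ≠ i}, inner ℝ (F (w - TT (R i))) (F (w - TT (R i)))
  set P := ∑ i, phi (fun i => TT (R i)) (TT (R i))
  set D := ∫ p : E2 × E2, ρ p.1 * ρ p.2 / ‖p.1 - p.2‖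
  set Q := ∫ x, phi (fun i => TT (R i)) (TT x) * ρ x
  have h2 : z ^ 2 * (Real.pi * S) ≤ z ^ 2 * I := by gcongr
  have h3 : 0 ≤ (8 * Real.pi) * (1 / 2 * D - z * Q + z ^ 2 / 2 * P - z ^ 2 / 8 * S) := by
    nlinarith
  have h4 := nonneg_of_mul_nonneg_right h3 (by positivity)
  linarith

theorem final_aux
    (K : ℕ) (hK : 2 ≤ K) (z : ℝ) (hz : 0 < z)
    (R : Fin K → EuclideanSpace ℝ (Fin 2)) (hR : Function.Injective R)
    (ρ : EuclideanSpace ℝ (Fin 2) → ℝ) (hρ0 : ∀ x, 0 ≤ ρ x)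
    (hL : Integrable (fun x => ρ x ^ ((3 : ℝ) / 2)))
    (hD : Integrable (fun p : EuclideanSpace ℝ (Fin 2) × EuclideanSpace ℝ (Fin 2) =>
        ρ p.1 * ρ p.2 / ‖p.1 - p.2‖))
    (hΦρ : Integrable (fun x =>
        ((∑ i : Fin K, z / ‖x - R i‖) - z / ⨅ i : Fin K, ‖x - R i‖) * ρ x)) :
    (1 / 2) * (∫ p : EuclideanSpace ℝ (Fin 2) × EuclideanSpace ℝ (Fin 2),
        ρ p.1 * ρ p.2 / ‖p.1 - p.2‖)
      - (∫ x, ((∑ i : Fin K, z / ‖x - R i‖) - z / ⨅ i : Fin K, ‖x - R i‖) * ρ x)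
      + ∑ i : Fin K, ∑ j ∈ Finset.Ioi i, z ^ 2 / ‖R i - R j‖
    ≥ z ^ 2 / 8 * ∑ j : Fin K,
        1 / ((1 / 2) * ⨅ k : {k : Fin K // k ≠ j}, ‖R k - R j‖) := by
  have hm : AEStronglyMeasurable ρ volume := by
    have h1 : AEMeasurable (fun x => (ρ x ^ ((3 : ℝ) / 2)) ^ ((2 : ℝ) / 3)) volume :=
      hL.1.aemeasurable.pow_const _
    have h2 : (fun x => (ρ x ^ ((3 : ℝ) / 2)) ^ ((2 : ℝ) / 3)) = ρ := by
      ext x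
      rw [← Real.rpow_mul (hρ0 x)]
      norm_num
    rw [h2] at h1
    exact h1.aestronglyMeasurable
  have hball : ∀ n : ℕ, IntegrableOn ρ (closedBall 0 n) := by
    intro n
    have h1 : IntegrableOn (fun x => 1 + ρ x ^ ((3 : ℝ) / 2)) (closedBall (0 : E2) n) := by
      refine Integrable.add ?_ hL.integrableOn
      exact integrableOn_const (measure_closedBall_lt_top.ne)
    refine Integrable.mono' h1 hm.restrict (.of_forall fun x => ?_)
    rw [Real.norm_of_nonneg (hρ0 x)]
    by_cases hx : ρ x ≤ 1
    · have := Real.rpow_nonneg (hρ0 x) ((3 : ℝ) / 2)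
      linarith
    · have := Real.self_le_rpow_of_one_le (not_le.1 hx).le (show (1 : ℝ) ≤ 3 / 2 by norm_num)
      linarith
  set ρn : ℕ → E2 → ℝ := fun n => (closedBall (0 : E2) n).indicator ρ with hρn
  have hcb : ∀ n : ℕ, MeasurableSet (closedBall (0 : E2) n) := fun n => measurableSet_closedBall
  have hcp : ∀ n : ℕ, MeasurableSet (closedBall (0 : E2 × E2) n) := fun n => measurableSet_closedBall
  have e1 : ∀ n, (fun p : E2 × E2 => ρn n p.1 * ρn n p.2 / ‖p.1 - p.2‖) =
      (closedBall (0 : E2 × E2) n).indicator (fun p => ρ p.1 * ρ p.2 / ‖p.1 - p.2‖) := by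
    intro n
    ext p
    by_cases h1 : p.1 ∈ closedBall (0 : E2) n <;> by_cases h2 : p.2 ∈ closedBall (0 : E2) n <;>
      simp [hρn, Set.indicator, h1, h2, Prod.norm_def] <;> simp_all
  have e2 : ∀ n, (fun x => ((∑ i : Fin K, z / ‖x - R i‖) - z / ⨅ i : Fin K, ‖x - R i‖) * ρn n x) =
      (closedBall (0 : E2) n).indicator
        (fun x => ((∑ i : Fin K, z / ‖x - R i‖) - z / ⨅ i : Fin K, ‖x - R i‖) * ρ x) := by
    intro n
    ext x
    by_cases h1 : x ∈ closedBall (0 : E2) n <;> simp [hρn, Set.indicator, h1]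
  have key := fun n => int_case hK z R hR (ρn n) ((integrable_indicator_iff (hcb n)).2 (hball n))
    (by rw [e1]; exact hD.indicator (hcp n))
  simp only [e1, e2] at key
  simp only [integral_indicator (hcb _), integral_indicator (hcp _)] at key
  have t1 := (aecover_closedBall (μ := (volume : Measure (E2 × E2))) (x := 0)
    tendsto_natCast_atTop_atTop).integral_tendsto_of_countably_generated hD
  have t2 := (aecover_closedBall (μ := (volume : Measure E2)) (x := 0)
    tendsto_natCast_atTop_atTop).integral_tendsto_of_countably_generated hΦρ
  exact ge_of_tendsto (((t1.const_mul (1 / 2)).sub t2).add_const _) (.of_forall key)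

end LY

/-- **Two-dimensional Lieb–Yau electrostatic inequality.** Let `R₁, …, R_K ∈ ℝ²` be
distinct nuclei of charge `z > 0`, with `D_j` half the distance from `R_j` to its
nearest neighbor. Let `Φ` be the potential of all nuclei except the nearest one, i.e.
`Φ(x) = Σ_i z/|x - R_i| - z / min_i |x - R_i|` (so that `Φ(x) = Σ_{i ≠ j} z/|x - R_i|`
on the Voronoi cell of `R_j`). Then for every nonnegative `ρ ∈ L^{3/2}(ℝ²)` with all
terms finite, `D(ρ,ρ) - ∫ Φ ρ + U ≥ (z²/8) Σ_j 1/D_j`. -/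
theorem electrostatic_inequality_two_dim
    (K : ℕ) (hK : 2 ≤ K) (z : ℝ) (hz : 0 < z)
    (R : Fin K → EuclideanSpace ℝ (Fin 2)) (hR : Function.Injective R)
    (ρ : EuclideanSpace ℝ (Fin 2) → ℝ) (hρ0 : ∀ x, 0 ≤ ρ x)
    (hL : Integrable (fun x => ρ x ^ ((3 : ℝ) / 2)))
    (hD : Integrable (fun p : EuclideanSpace ℝ (Fin 2) × EuclideanSpace ℝ (Fin 2) =>
        ρ p.1 * ρ p.2 / ‖p.1 - p.2‖))
    (hΦρ : Integrable (fun x =>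
        ((∑ i : Fin K, z / ‖x - R i‖) - z / ⨅ i : Fin K, ‖x - R i‖) * ρ x)) :
    (1 / 2) * (∫ p : EuclideanSpace ℝ (Fin 2) × EuclideanSpace ℝ (Fin 2),
        ρ p.1 * ρ p.2 / ‖p.1 - p.2‖)
      - (∫ x, ((∑ i : Fin K, z / ‖x - R i‖) - z / ⨅ i : Fin K, ‖x - R i‖) * ρ x)
      + ∑ i : Fin K, ∑ j ∈ Finset.Ioi i, z ^ 2 / ‖R i - R j‖
    ≥ z ^ 2 / 8 * ∑ j : Fin K,
        1 / ((1 / 2) * ⨅ k : {k : Fin K // k ≠ j}, ‖R k - R j‖) := by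
  exact LY.final_aux K hK z hz R hR ρ hρ0 hL hD hΦρ
end

section
/- Let N > 0, A > 0, and set C = N A / π, ρ(x) = C e^{−A|x|²} for x ∈ ℝ². Then ∫_{ℝ²} ρ(x) dx = N and the ratio G/L = 3π/(2N), where L = ∫_{ℝ²} ρ(x)^{3/2} dx and G = ∫_{ℝ²} |∇ρ(x)^{1/4}|² dx. In particular, G/L → 0 as N → ∞. -/
open MeasureTheory Filter

lemma aux_gauss {a : ℝ} (ha : 0 < a) :
    (∫ x : EuclideanSpace ℝ (Fin 2), Real.exp (-a * ‖x‖ ^ 2)) = Real.pi / a := by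
  rw [GaussianFourier.integral_rexp_neg_mul_sq_norm ha]
  simp

lemma aux_moment {a : ℝ} (ha : 0 < a) :
    (∫ x : EuclideanSpace ℝ (Fin 2), ‖x‖ ^ 2 * Real.exp (-a * ‖x‖ ^ 2)) = Real.pi / a ^ 2 := by
  have h := integral_fun_norm_addHaar (volume : Measure (EuclideanSpace ℝ (Fin 2)))
    (fun r : ℝ => r ^ 2 * Real.exp (-a * r ^ 2))
  have hv : (volume : Measure (EuclideanSpace ℝ (Fin 2))).real (Metric.ball 0 1) = Real.pi := by
    simp [Measure.real, EuclideanSpace.volume_ball_fin_two, Real.pi_pos.le]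
  have h1 := integral_rpow_mul_exp_neg_mul_rpow (p := 2) (q := 3) (b := a)
    (by norm_num) (by norm_num) ha
  have h2 : (∫ y in Set.Ioi (0 : ℝ), y ^ (2 - 1) • (y ^ 2 * Real.exp (-a * y ^ 2)))
      = a ^ (-(3 + 1 : ℝ) / 2) * (1 / 2) * Real.Gamma ((3 + 1) / 2) := by
    rw [← h1]
    refine setIntegral_congr_fun measurableSet_Ioi fun y hy => ?_
    have e1 : y ^ (3 : ℝ) = y ^ 3 := by exact_mod_cast Real.rpow_natCast y 3
    have e2 : y ^ (2 : ℝ) = y ^ 2 := by exact_mod_cast Real.rpow_natCast y 2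
    simp only [smul_eq_mul, e1, e2]
    ring
  have h3 : a ^ (-(3 + 1 : ℝ) / 2) = (a ^ 2)⁻¹ := by
    rw [show (-(3 + 1 : ℝ) / 2) = -(2 : ℕ) by norm_num, Real.rpow_neg ha.le, Real.rpow_natCast]
  have h4 : Real.Gamma ((3 + 1) / 2) = 1 := by
    rw [show ((3 + 1 : ℝ) / 2) = 2 by norm_num, Real.Gamma_two]
  rw [h, finrank_euclideanSpace_fin, hv, h2, h3, h4]
  simp only [nsmul_eq_mul, smul_eq_mul]
  push_cast
  field_simp

lemma aux_pow {C : ℝ} (hC : 0 < C) (A r s : ℝ) :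
    (C * Real.exp (-A * r)) ^ s = C ^ s * Real.exp (-(A * s) * r) := by
  rw [Real.mul_rpow hC.le (Real.exp_pos _).le, ← Real.exp_mul]
  congr 2
  ring

lemma aux_grad_s13 (c b : ℝ) (x : EuclideanSpace ℝ (Fin 2)) :
    ‖fderiv ℝ (fun y : EuclideanSpace ℝ (Fin 2) => c * Real.exp (-b * ‖y‖ ^ 2)) x‖ ^ 2
      = 4 * c ^ 2 * b ^ 2 * (‖x‖ ^ 2 * Real.exp (-(2 * b) * ‖x‖ ^ 2)) := by
  have h := ((((hasStrictFDerivAt_norm_sq x).hasFDerivAt.const_mul (-b)).exp).const_mul c).fderiv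
  rw [h]
  simp only [norm_smul, innerSL_apply_norm, mul_pow, Real.norm_eq_abs, sq_abs, nsmul_eq_mul]
  rw [show (2 • innerSL ℝ x : EuclideanSpace ℝ (Fin 2) →L[ℝ] ℝ) = (2 : ℝ) • innerSL ℝ x by
    rw [two_smul, two_smul]]
  rw [norm_smul, innerSL_apply_norm, ← Real.exp_nat_mul]
  norm_num
  ring_nf

/-- **Normalized Gaussian example.** For `N, A > 0`, `C = NA/π` and
`ρ(x) = C e^{-A|x|²}` on `ℝ²`, one has `∫ ρ = N` and `G/L = 3π/(2N)`, where
`L = ∫ ρ^{3/2}` and `G = ∫ |∇ρ^{1/4}|²`; in particular `3π/(2N) → 0` as `N → ∞`. -/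
theorem gaussian_ratio_two_dim (N A : ℝ) (hN : 0 < N) (hA : 0 < A) :
    (∫ x : EuclideanSpace ℝ (Fin 2), N * A / Real.pi * Real.exp (-A * ‖x‖ ^ 2)) = N ∧
    (∫ x : EuclideanSpace ℝ (Fin 2),
        ‖fderiv ℝ (fun y : EuclideanSpace ℝ (Fin 2) =>
          (N * A / Real.pi * Real.exp (-A * ‖y‖ ^ 2)) ^ ((1 : ℝ) / 4)) x‖ ^ 2)
      / (∫ x : EuclideanSpace ℝ (Fin 2),
          (N * A / Real.pi * Real.exp (-A * ‖x‖ ^ 2)) ^ ((3 : ℝ) / 2))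
      = 3 * Real.pi / (2 * N) ∧
    Tendsto (fun n : ℝ => 3 * Real.pi / (2 * n)) atTop (nhds 0) := by
  have hπ := Real.pi_pos
  have hC : 0 < N * A / Real.pi := by positivity
  refine ⟨?_, ?_, ?_⟩
  · rw [integral_const_mul, aux_gauss hA]
    field_simp
  · simp only [aux_pow hC, aux_grad_s13, integral_const_mul]
    rw [aux_moment (by positivity), aux_gauss (by positivity)]
    have e : (N * A / Real.pi) ^ ((3 : ℝ) / 2)
        = ((N * A / Real.pi) ^ ((1 : ℝ) / 4)) ^ 2 * (N * A / Real.pi) := by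
      rw [← Real.rpow_natCast, ← Real.rpow_mul hC.le]
      nth_rewrite 3 [← Real.rpow_one (N * A / Real.pi)]
      rw [← Real.rpow_add hC]
      norm_num
    rw [e]
    have : 0 < (N * A / Real.pi) ^ ((1 : ℝ) / 4) := by positivity
    generalize (N * A / Real.pi) ^ ((1 : ℝ) / 4) = t at *
    field_simp
    try norm_num
  · have : Tendsto (fun n : ℝ => (3 * Real.pi / 2) / n) atTop (nhds 0) :=
      tendsto_const_nhds.div_atTop tendsto_id
    refine this.congr fun n => ?_
    rw [div_div]
end
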